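/- arXiv:math/9901063 — 10 statements merged into one kernel-verified Lean document; each statement's English description precedes it below -/
import Mathlib

section
/- Let X be a topological space, Y a dense subset of X, and ψ : Y → [0,∞] a lower semicontinuous function (for the subspace topology on Y). Define ψ̂ : X → [0,∞] by ψ̂(x) = inf { L ∈ [0,∞] : x belongs to the closure in X of { y ∈ Y : ψ(y) ≤ L } } (with inf ∅ = ∞); equivalently, ψ̂(x) is the infimum of all L for which there exists a net in Y converging to x on which ψ is bounded by L. Then: (1) ψ̂(y) = ψ(y) for every y ∈ Y; (2) ψ̂ is lower semicontinuous on X; (3) for every lower semicontinuous function η : X → [0,∞] with η(y) = ψ(y) for all y ∈ Y, one has η(x) ≤ ψ̂(x) for all x ∈ X. -/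
open Filter Topology

/-- Baaj's extension of a lower semicontinuous `[0,∞]`-valued function on a dense subspace:
`ψ̂(x) = inf { L | x ∈ closure {y ∈ Y | ψ(y) ≤ L} }` agrees with `ψ` on `Y`, is lower
semicontinuous, and dominates every lower semicontinuous extension of `ψ`. -/
theorem extension_of_lsc_on_dense_subset
    {X : Type*} [TopologicalSpace X] (Y : Set X) (hY : Dense Y)
    (ψ : Y → ENNReal) (hψ : LowerSemicontinuous ψ)
    (ψhat : X → ENNReal)
    (hdef : ∀ x : X,
      ψhat x = sInf {L : ENNReal | x ∈ closure {y : X | ∃ hy : y ∈ Y, ψ ⟨y, hy⟩ ≤ L}}) :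
    (∀ (y : X) (hy : y ∈ Y), ψhat y = ψ ⟨y, hy⟩) ∧
    LowerSemicontinuous ψhat ∧
    (∀ η : X → ENNReal, LowerSemicontinuous η →
      (∀ (y : X) (hy : y ∈ Y), η y = ψ ⟨y, hy⟩) → ∀ x : X, η x ≤ ψhat x) := by
  refine ⟨fun y hy => ?_, fun x a ha => ?_, fun η hη hext x => ?_⟩
  · rw [hdef]
    refine le_antisymm (sInf_le (subset_closure ⟨hy, le_rfl⟩)) (le_sInf fun L hL => ?_)
    have himage : {y : X | ∃ hy : y ∈ Y, ψ ⟨y, hy⟩ ≤ L} = (↑) '' (ψ ⁻¹' Set.Iic L) := by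
      ext z
      simp
    have hmem : (⟨y, hy⟩ : Y) ∈ closure (ψ ⁻¹' Set.Iic L) := by
      rw [closure_subtype, ← himage]
      exact hL
    rwa [(hψ.isClosed_preimage L).closure_eq] at hmem
  · obtain ⟨b, hab, hb⟩ := exists_between ha
    have hx : x ∉ closure {y : X | ∃ hy : y ∈ Y, ψ ⟨y, hy⟩ ≤ b} := fun h =>
      hb.not_ge ((hdef x).trans_le (sInf_le h))
    filter_upwards [isClosed_closure.isOpen_compl.mem_nhds hx] with z hz
    refine hab.trans_le ?_
    rw [hdef]
    refine le_sInf fun L hL => ?_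
    by_contra! hLb
    refine hz (closure_mono ?_ hL)
    rintro y ⟨hy, hyL⟩
    exact ⟨hy, hyL.trans hLb.le⟩
  · rw [hdef]
    refine le_sInf fun L hL => ?_
    refine closure_minimal ?_ (hη.isClosed_preimage L) hL
    rintro y ⟨hy, hyL⟩
    exact (hext y hy).trans_le hyL
end

section
/- Let A be a C*-algebra and (b_i)_{i∈I} an increasing net of positive elements of the multiplier algebra M(A) (indexed by a nonempty directed set I, with b_i ≤ b_j whenever i ≤ j). Then there exists a positive element b ∈ M(A) such that (b_i)_{i∈I} converges strictly to b if and only if for every a ∈ A the net (a* b_i a)_{i∈I} is convergent in norm. -/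
open scoped MultiplierAlgebra
open Filter Topology

namespace DoubleCentralizer

variable {A : Type*} [NonUnitalCStarAlgebra A]

theorem _root_.IsSelfAdjoint.multiplier_snd_apply {m : 𝓜(ℂ, A)} (hm : IsSelfAdjoint m) (a : A) :
    m.snd a = star (m.fst (star a)) := by
  rw [← star_snd, hm.star_eq]

theorem star_fst_apply_mul_fst_apply {s : 𝓜(ℂ, A)} (hs : IsSelfAdjoint s) (a : A) :
    star (s.fst a) * s.fst a = star a * (s * s).fst a := by
  have h := s.central (star a) (s.fst a)
  rwa [hs.multiplier_snd_apply, star_star] at h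

theorem norm_fst_apply_sq {s : 𝓜(ℂ, A)} (hs : IsSelfAdjoint s) (a : A) :
    ‖s.fst a‖ ^ 2 = ‖star a * (s * s).fst a‖ := by
  rw [← star_fst_apply_mul_fst_apply hs, CStarRing.norm_star_mul_self, sq]

section Order

variable [PartialOrder 𝓜(ℂ, A)] [StarOrderedRing 𝓜(ℂ, A)]

theorem exists_isSelfAdjoint_mul_self_eq {m : 𝓜(ℂ, A)} (hm : 0 ≤ m) :
    ∃ s : 𝓜(ℂ, A), IsSelfAdjoint s ∧ s * s = m :=
  ⟨CFC.sqrt m, .of_nonneg (CFC.sqrt_nonneg m), CFC.sqrt_mul_sqrt_self m hm⟩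

theorem norm_star_mul_fst_le_of_le {m n : 𝓜(ℂ, A)} (hm : 0 ≤ m) (hmn : m ≤ n) (a : A) :
    ‖star a * m.fst a‖ ≤ ‖star a * n.fst a‖ := by
  let _ := CStarAlgebra.spectralOrder A
  have := CStarAlgebra.spectralOrderedRing A
  obtain ⟨s, hs, rfl⟩ := exists_isSelfAdjoint_mul_self_eq hm
  obtain ⟨t, ht, h⟩ := exists_isSelfAdjoint_mul_self_eq (sub_nonneg.2 hmn)
  refine CStarAlgebra.norm_le_norm_of_nonneg_of_le ?_ ?_
  · rw [← star_fst_apply_mul_fst_apply hs]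
    exact star_mul_self_nonneg _
  · rw [← sub_nonneg, ← mul_sub, ← sub_apply, ← sub_fst, ← h,
      ← star_fst_apply_mul_fst_apply ht]
    exact star_mul_self_nonneg _

theorem norm_fst_apply_sq_le {m : 𝓜(ℂ, A)} (hm : 0 ≤ m) (a : A) :
    ‖m.fst a‖ ^ 2 ≤ ‖m‖ * ‖star a * m.fst a‖ := by
  obtain ⟨s, hs, rfl⟩ := exists_isSelfAdjoint_mul_self_eq hm
  have hnorm : ‖s * s‖ = ‖s‖ ^ 2 := by
    rw [sq, ← CStarRing.norm_self_mul_star, hs.star_eq]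
  rw [hnorm, ← norm_fst_apply_sq hs, ← mul_pow, ← norm_fst s]
  gcongr
  exact s.fst.le_opNorm (s.fst a)

theorem exists_norm_le_of_norm_star_mul_fst_le {ι : Type*} {b : ι → 𝓜(ℂ, A)}
    (hpos : ∀ i, 0 ≤ b i) (h : ∀ a : A, ∃ C, ∀ i, ‖star a * (b i).fst a‖ ≤ C) :
    ∃ C, ∀ i, ‖b i‖ ≤ C := by
  choose s hs hsb using fun i => exists_isSelfAdjoint_mul_self_eq (hpos i)
  obtain ⟨K, hK⟩ := banach_steinhaus (g := fun i => (s i).fst) fun a => by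
    obtain ⟨C, hC⟩ := h a
    refine ⟨√C, fun i => Real.le_sqrt_of_sq_le ?_⟩
    rw [norm_fst_apply_sq (hs i), hsb]
    exact hC i
  refine ⟨K * K, fun i => ?_⟩
  have hsK : ‖s i‖ ≤ K := norm_fst (s i) ▸ hK i
  rw [← hsb]
  exact (norm_mul_le _ _).trans (mul_self_le_mul_self (norm_nonneg _) hsK)

theorem nonneg_of_tendsto_fst {ι : Type*} {l : Filter ι} [l.NeBot] {b : ι → 𝓜(ℂ, A)}
    {m : 𝓜(ℂ, A)} {C : ℝ} (hpos : ∀ i, 0 ≤ b i) (hC : ∀ i, ‖b i‖ ≤ C) (hm : IsSelfAdjoint m)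
    (h : ∀ a : A, Tendsto (fun i => (b i).fst a) l (𝓝 (m.fst a))) : 0 ≤ m := by
  obtain ⟨i₀⟩ := l.nonempty_of_neBot
  have hC₀ : 0 ≤ C := (norm_nonneg _).trans (hC i₀)
  have hb (i : ι) : ‖algebraMap ℝ 𝓜(ℂ, A) C - b i‖ ≤ C := by
    have hi := (CStarAlgebra.mem_Icc_algebraMap_iff_norm_le hC₀).2 ⟨hpos i, hC i⟩
    exact ((CStarAlgebra.mem_Icc_algebraMap_iff_norm_le hC₀).1
      ⟨sub_nonneg.2 hi.2, sub_le_self _ hi.1⟩).2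
  have hnorm : ‖algebraMap ℝ 𝓜(ℂ, A) C - m‖ ≤ C := by
    rw [← norm_fst]
    refine ContinuousLinearMap.opNorm_le_bound _ hC₀ fun a => ?_
    have ht : Tendsto (fun i => (algebraMap ℝ 𝓜(ℂ, A) C - b i).fst a) l
        (𝓝 ((algebraMap ℝ 𝓜(ℂ, A) C - m).fst a)) := by
      simpa only [sub_fst, sub_apply] using (h a).const_sub _
    refine le_of_tendsto ht.norm (.of_forall fun i => ?_)
    refine ContinuousLinearMap.le_of_opNorm_le _ ?_ a
    rw [norm_fst]
    exact hb i
  have hsa : IsSelfAdjoint (algebraMap ℝ 𝓜(ℂ, A) C - m) :=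
    (IsSelfAdjoint.algebraMap _ (.all C)).sub hm
  have := hsa.le_algebraMap_norm_self.trans (algebraMap_mono _ hnorm)
  exact (sub_le_self_iff _).1 this

end Order

/-- The pointwise limit of a bounded family of self-adjoint multipliers is a multiplier. -/
theorem exists_isSelfAdjoint_tendsto {ι : Type*} {l : Filter ι} [l.NeBot] {b : ι → 𝓜(ℂ, A)}
    {C : ℝ} (hsa : ∀ i, IsSelfAdjoint (b i)) (hC : ∀ i, ‖b i‖ ≤ C)
    (h : ∀ a : A, ∃ c, Tendsto (fun i => (b i).fst a) l (𝓝 c)) :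
    ∃ m : 𝓜(ℂ, A), IsSelfAdjoint m ∧ ∀ a : A,
      Tendsto (fun i => (b i).fst a) l (𝓝 (m.fst a)) ∧
      Tendsto (fun i => (b i).snd a) l (𝓝 (m.snd a)) := by
  choose f hf using h
  have hg (a : A) : Tendsto (fun i => (b i).snd a) l (𝓝 (star (f (star a)))) := by
    simpa only [(hsa _).multiplier_snd_apply] using (hf (star a)).star
  have hL : Bornology.IsBounded (Set.range fun i => (b i).fst) :=
    isBounded_iff_forall_norm_le.2 ⟨C, by rintro _ ⟨i, rfl⟩; simpa only [norm_fst] using hC i⟩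
  have hR : Bornology.IsBounded (Set.range fun i => (b i).snd) :=
    isBounded_iff_forall_norm_le.2 ⟨C, by rintro _ ⟨i, rfl⟩; simpa only [norm_snd] using hC i⟩
  let m : 𝓜(ℂ, A) :=
    { fst := ContinuousLinearMap.ofTendstoOfBoundedRange f _ (tendsto_pi_nhds.2 hf) hL
      snd := ContinuousLinearMap.ofTendstoOfBoundedRange _ _ (tendsto_pi_nhds.2 hg) hR
      central := fun x y => by
        refine tendsto_nhds_unique ((hg x).mul_const y) ?_
        exact ((hf y).const_mul x).congr fun i => ((b i).central x y).symm }
  refine ⟨m, ?_, fun a => ⟨hf a, hg a⟩⟩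
  refine DoubleCentralizer.ext _ _ _ _ (Prod.ext ?_ ?_) <;> ext a
  · rw [star_fst]
    change star (star (f (star (star a)))) = f a
    simp only [star_star]
  · rw [star_snd]
    rfl

end DoubleCentralizer

section Net

variable {ι : Type*} [Preorder ι] [IsDirected ι (· ≤ ·)] [Nonempty ι]

theorem exists_tendsto_atTop_of_forall_exists_dist_lt {X : Type*} [PseudoMetricSpace X]
    [CompleteSpace X] {f : ι → X} (h : ∀ ε > 0, ∃ i₀, ∀ i ≥ i₀, dist (f i) (f i₀) < ε) :
    ∃ x, Tendsto f atTop (𝓝 x) := by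
  refine CompleteSpace.complete (Metric.cauchy_iff.2 ⟨inferInstance, fun ε hε => ?_⟩)
  obtain ⟨i₀, hi₀⟩ := h (ε / 2) (half_pos hε)
  refine ⟨f '' Set.Ici i₀, image_mem_map (Ici_mem_atTop i₀), ?_⟩
  rintro _ ⟨i, hi, rfl⟩ _ ⟨j, hj, rfl⟩
  linarith [dist_triangle_right (f i) (f j) (f i₀), hi₀ i hi, hi₀ j hj]

variable {A : Type*} [NonUnitalCStarAlgebra A] [PartialOrder 𝓜(ℂ, A)] [StarOrderedRing 𝓜(ℂ, A)]
  {b : ι → 𝓜(ℂ, A)}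

theorem DoubleCentralizer.exists_norm_le_of_tendsto_star_mul_fst
    (hpos : ∀ i, 0 ≤ b i) (hmono : Monotone b)
    (h : ∀ a : A, ∃ c : A, Tendsto (fun i => star a * (b i).fst a) atTop (𝓝 c)) :
    ∃ C, ∀ i, ‖b i‖ ≤ C := by
  refine exists_norm_le_of_norm_star_mul_fst_le hpos fun a => ?_
  obtain ⟨c, hc⟩ := h a
  refine ⟨‖c‖ + 1, fun i => ?_⟩
  obtain ⟨j, hj, hij⟩ := ((hc.norm.eventually_le_const (lt_add_one ‖c‖)).and
    (eventually_ge_atTop i)).exists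
  exact (norm_star_mul_fst_le_of_le (hpos i) (hmono hij) a).trans hj

theorem DoubleCentralizer.exists_tendsto_fst_of_tendsto_star_mul_fst
    (hpos : ∀ i, 0 ≤ b i) (hmono : Monotone b) {C : ℝ} (hC : ∀ i, ‖b i‖ ≤ C) {a c : A}
    (h : Tendsto (fun i => star a * (b i).fst a) atTop (𝓝 c)) :
    ∃ x, Tendsto (fun i => (b i).fst a) atTop (𝓝 x) := by
  refine exists_tendsto_atTop_of_forall_exists_dist_lt fun ε hε => ?_
  have hC₀ : 0 ≤ C := (norm_nonneg _).trans (hC (Classical.arbitrary ι))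
  set δ := ε ^ 2 / (2 * (C + 1))
  have hδ : 0 < δ := by positivity
  obtain ⟨i₀, hi₀⟩ := eventually_atTop.1 (Metric.tendsto_nhds.1 h δ hδ)
  refine ⟨i₀, fun i hi => ?_⟩
  have hd : 0 ≤ b i - b i₀ := sub_nonneg.2 (hmono hi)
  have hdC : ‖b i - b i₀‖ ≤ C :=
    (CStarAlgebra.norm_le_norm_of_nonneg_of_le hd (sub_le_self _ (hpos i₀))).trans (hC i)
  have hda : ‖star a * (b i - b i₀).fst a‖ ≤ δ + δ := by
    rw [sub_fst, sub_apply, mul_sub, ← dist_eq_norm]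
    exact (dist_triangle_right _ _ c).trans (add_le_add (hi₀ i hi).le (hi₀ i₀ le_rfl).le)
  rw [dist_eq_norm, ← sub_apply, ← sub_fst]
  refine lt_of_pow_lt_pow_left₀ 2 hε.le ?_
  calc ‖(b i - b i₀).fst a‖ ^ 2 ≤ ‖b i - b i₀‖ * ‖star a * (b i - b i₀).fst a‖ :=
        norm_fst_apply_sq_le hd a
    _ ≤ C * (δ + δ) := by gcongr
    _ < (C + 1) * (δ + δ) := by gcongr; exact lt_add_one C
    _ = ε ^ 2 := by simp only [δ]; field_simp; ring

end Net

open Filter Topology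

/-- An increasing net `(b_i)` of positive elements of the multiplier algebra of a C*-algebra `A`
converges strictly to some positive element `b` iff the net `(a* b_i a)` is norm-convergent in
`A` for every `a ∈ A`.  Here `m.fst a` is `m·a` and `m.snd a` is `a·m`. -/
theorem increasing_net_strictly_convergent_iff
    {A : Type*} [NonUnitalCStarAlgebra A]
    [PartialOrder 𝓜(ℂ, A)] [StarOrderedRing 𝓜(ℂ, A)]
    {ι : Type*} [Preorder ι] [IsDirected ι (· ≤ ·)] [Nonempty ι]
    (b : ι → 𝓜(ℂ, A)) (hpos : ∀ i, 0 ≤ b i) (hmono : Monotone b) :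
    (∃ b₀ : 𝓜(ℂ, A), 0 ≤ b₀ ∧ ∀ a : A,
        Tendsto (fun i => (b i).fst a) atTop (𝓝 (b₀.fst a)) ∧
        Tendsto (fun i => (b i).snd a) atTop (𝓝 (b₀.snd a))) ↔
    (∀ a : A, ∃ c : A, Tendsto (fun i => star a * (b i).fst a) atTop (𝓝 c)) := by
  constructor
  · rintro ⟨b₀, -, h⟩ a
    exact ⟨_, (h a).1.const_mul (star a)⟩
  · intro h
    obtain ⟨C, hC⟩ := DoubleCentralizer.exists_norm_le_of_tendsto_star_mul_fst hpos hmono h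
    obtain ⟨m, hm, hlim⟩ := DoubleCentralizer.exists_isSelfAdjoint_tendsto
      (fun i => .of_nonneg (hpos i)) hC fun a =>
        (h a).elim fun _ => DoubleCentralizer.exists_tendsto_fst_of_tendsto_star_mul_fst
          hpos hmono hC
    exact ⟨m, DoubleCentralizer.nonneg_of_tendsto_fst hpos hC hm fun a => (hlim a).1, hlim⟩
end

section
/- Let A be a C*-algebra, (a_i)_{i∈I} an increasing net of positive elements of A (indexed by a nonempty directed set), and a ∈ A a positive element. Suppose that for every positive continuous linear functional ω on A (i.e., ω : A → ℂ continuous linear with ω(x) ≥ 0 for every x ≥ 0) the nonnegative real number ω(a) is the supremum of the set of (nonnegative real) values {ω(a_i) : i ∈ I}. Then the net (a_i)_{i∈I} converges to a in norm. -/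
open Filter Topology ComplexOrder

/-- A linear functional whose real part is bounded below on the positive cone has nonnegative
real part there. -/
theorem re_nonneg_of_lt_re {A : Type*} [NonUnitalCStarAlgebra A] [PartialOrder A]
    [StarOrderedRing A] (f : A →L[ℂ] ℂ) (u : ℝ) (hf : ∀ p : A, 0 ≤ p → u < (f p).re)
    (p : A) (hp : 0 ≤ p) : 0 ≤ (f p).re := by
  by_contra! hneg
  obtain ⟨n, hn⟩ := exists_nat_gt (u / (f p).re)
  have hlt := hf (n • p) (nsmul_nonneg hp n)
  rw [div_lt_iff_of_neg hneg] at hn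
  simp at hlt
  linarith

/-- If the real part of `f` is nonnegative on the positive cone, then some positive functional
has twice the real part of `f` on selfadjoint elements. -/
theorem exists_positive_functional_re_eq {A : Type*} [NonUnitalCStarAlgebra A] [PartialOrder A]
    [StarOrderedRing A] (f : A →L[ℂ] ℂ) (hf : ∀ p : A, 0 ≤ p → 0 ≤ (f p).re) :
    ∃ ω : A →L[ℂ] ℂ, (∀ x : A, 0 ≤ x → 0 ≤ ω x) ∧
      ∀ x : A, IsSelfAdjoint x → (ω x).re = 2 * (f x).re := by
  let g : A →L[ℂ] ℂ :=
    ((starL ℂ : ℂ ≃L⋆[ℂ] ℂ) : ℂ →L⋆[ℂ] ℂ).comp (f.comp ((starL ℂ : A ≃L⋆[ℂ] A) : A →L⋆[ℂ] A))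
  have hg (x : A) (hx : IsSelfAdjoint x) : g x = star (f x) := by
    simp [g, hx.star_eq]
  refine ⟨f + g, fun x hx => ?_, fun x hx => ?_⟩
  · have := hf x hx
    rw [Complex.nonneg_iff]
    simp [hg x (IsSelfAdjoint.of_nonneg hx), this]
  · simp [hg x hx, two_mul]

/-- If `(a_i)` is an increasing net of positive elements of a C*-algebra `A`, `a` is positive,
and for every positive continuous linear functional `ω` on `A` the value `ω(a)` is the
supremum of the values `ω(a_i)`, then `a_i → a` in norm. -/
theorem tendsto_of_forall_positive_functional_isLUB
    {A : Type*} [NonUnitalCStarAlgebra A] [PartialOrder A] [StarOrderedRing A]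
    {ι : Type*} [Preorder ι] [IsDirected ι (· ≤ ·)] [Nonempty ι]
    (a : ι → A) (hpos : ∀ i, 0 ≤ a i) (hmono : Monotone a)
    (a₀ : A) (ha₀ : 0 ≤ a₀)
    (h : ∀ ω : A →L[ℂ] ℂ, (∀ x : A, 0 ≤ x → 0 ≤ ω x) →
      IsLUB (Set.range fun i => (ω (a i)).re) (ω a₀).re) :
    Tendsto a atTop (𝓝 a₀) := by
  have hLUB (f : A →L[ℂ] ℂ) (hf : ∀ p : A, 0 ≤ p → 0 ≤ (f p).re) :
      IsLUB (Set.range fun i => (f (a i)).re) (f a₀).re := by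
    obtain ⟨ω, hω, hre⟩ := exists_positive_functional_re_eq f hf
    have hω' := h ω hω
    simp only [hre _ (IsSelfAdjoint.of_nonneg (hpos _)), hre _ (IsSelfAdjoint.of_nonneg ha₀)]
      at hω'
    refine ⟨?_, fun b hb => ?_⟩
    · rintro _ ⟨i, rfl⟩
      have := hω'.1 ⟨i, rfl⟩
      dsimp only at this ⊢
      linarith
    · have := hω'.2 (show 2 * b ∈ upperBounds _ by
        rintro _ ⟨i, rfl⟩
        have := hb ⟨i, rfl⟩
        dsimp only at this ⊢
        linarith)
      linarith
  have hle (i : ι) : a i ≤ a₀ := by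
    rw [← sub_nonneg]
    by_contra hnot
    have hconv : Convex ℝ {x : A | 0 ≤ x} := fun x hx y hy s t hs ht _ =>
      add_nonneg (smul_nonneg hs hx) (smul_nonneg ht hy)
    obtain ⟨f, u, hlt, hu⟩ := RCLike.geometric_hahn_banach_point_closed (𝕜 := ℂ) hconv
      CStarAlgebra.isClosed_nonneg hnot
    have hu0 : u < 0 := by simpa using hu 0 le_rfl
    have := (hLUB f (re_nonneg_of_lt_re f u hu)).1 ⟨i, rfl⟩
    simp at this hlt
    linarith
  let C : Set A := {x | ∃ i, x ≤ a i}
  have hC : Convex ℝ C := by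
    rintro x ⟨i, hi⟩ y ⟨j, hj⟩ s t hs ht hst
    obtain ⟨k, hik, hjk⟩ := exists_ge_ge i j
    refine ⟨k, ?_⟩
    calc s • x + t • y ≤ s • a k + t • a k :=
          add_le_add (smul_le_smul_of_nonneg_left (hi.trans (hmono hik)) hs)
            (smul_le_smul_of_nonneg_left (hj.trans (hmono hjk)) ht)
      _ = a k := by rw [← add_smul, hst, one_smul]
  have hmem : a₀ ∈ closure C := by
    by_contra hnot
    obtain ⟨f, u, hu, hlt⟩ := RCLike.geometric_hahn_banach_closed_point (𝕜 := ℂ) hC.closure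
      isClosed_closure hnot
    have hu' (x : A) (i : ι) (hx : x ≤ a i) : (f x).re < u := hu x (subset_closure ⟨i, hx⟩)
    obtain ⟨i₀⟩ := ‹Nonempty ι›
    have hf := re_nonneg_of_lt_re f ((f (a i₀)).re - u) fun p hp => by
      have := hu' (a i₀ - p) i₀ (sub_le_self _ hp)
      simp at this
      linarith
    refine absurd hlt (not_lt.mpr ((hLUB f hf).2 ?_))
    rintro _ ⟨i, rfl⟩
    exact (hu' _ i le_rfl).le
  refine Metric.tendsto_nhds.mpr fun ε hε => ?_
  obtain ⟨x, ⟨i, hxi⟩, hx⟩ := Metric.mem_closure_iff.mp hmem ε hε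
  filter_upwards [eventually_ge_atTop i] with j hij
  rw [dist_comm, dist_eq_norm]
  rw [dist_eq_norm] at hx
  exact (CStarAlgebra.norm_le_norm_of_nonneg_of_le (sub_nonneg.mpr (hle j))
    (sub_le_sub_left (hxi.trans (hmono hij)) a₀)).trans_lt hx
end

section
/- Let A be a C*-algebra, (a_i)_{i∈I} an increasing net of positive elements of the multiplier algebra M(A) (indexed by a nonempty directed set), and a ∈ M(A) a positive element. Suppose that for every positive linear functional ω on M(A) that is continuous for the strict topology, the nonnegative real number ω(a) is the supremum of the set of values {ω(a_i) : i ∈ I}. Then the net (a_i)_{i∈I} converges strictly to a. -/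
open scoped MultiplierAlgebra
open Filter Topology ComplexOrder

/-- The strict topology on the multiplier algebra `𝓜(ℂ, A)`: the initial topology induced by
the maps `m ↦ m·a` and `m ↦ a·m` (for `a ∈ A`) into `A` with its norm topology. -/
noncomputable def strictTopology (A : Type*) [NonUnitalCStarAlgebra A] :
    TopologicalSpace 𝓜(ℂ, A) :=
  ⨅ a : A,
    TopologicalSpace.induced (fun m : 𝓜(ℂ, A) => m.fst a) inferInstance ⊓
    TopologicalSpace.induced (fun m : 𝓜(ℂ, A) => m.snd a) inferInstance

section CStarAlgebra

variable {B : Type*} [CStarAlgebra B] [PartialOrder B] [StarOrderedRing B]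

/-- A continuous functional with nonnegative real part on the positive cone can be symmetrized to
a positive functional without changing its real part on self-adjoint elements. -/
lemma exists_positive_functional_re_eq_s5 (f : B →L[ℂ] ℂ) (hf : ∀ m, 0 ≤ m → 0 ≤ (f m).re) :
    ∃ φ : B →L[ℂ] ℂ, (∀ m, 0 ≤ m → 0 ≤ φ m) ∧
      ∀ m, IsSelfAdjoint m → (φ m).re = 2 * (f m).re := by
  let g : B →L[ℂ] ℂ := ((starL ℂ : ℂ ≃L⋆[ℂ] ℂ) : ℂ →L⋆[ℂ] ℂ) ∘SL f ∘SL
    ((starL ℂ : B ≃L⋆[ℂ] B) : B →L⋆[ℂ] B)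
  have hg (m : B) : g m = star (f (star m)) := rfl
  refine ⟨f + g, fun m hm => ?_, fun m hm => ?_⟩
  · have := hf m hm
    rw [Complex.nonneg_iff]
    simp [hg, (IsSelfAdjoint.of_nonneg hm).star_eq]
    linarith
  · simp [hg, hm.star_eq]
    ring

/-- A self-adjoint element on which all positive functionals are nonnegative is positive. -/
lemma nonneg_of_forall_positive_functional {x : B} (hx : IsSelfAdjoint x)
    (h : ∀ φ : B →L[ℂ] ℂ, (∀ m, 0 ≤ m → 0 ≤ φ m) → 0 ≤ (φ x).re) : 0 ≤ x := by
  by_contra hneg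
  obtain ⟨f, u, hfu, hux⟩ := RCLike.geometric_hahn_banach_closed_point (𝕜 := ℂ)
    (s := {z : B | 0 ≤ z}) (x := x) (convex_Ici 0) isClosed_Ici hneg
  have hu : 0 < u := by simpa using hfu 0 le_rfl
  have hf (m : B) (hm : 0 ≤ m) : 0 ≤ ((-f) m).re := by
    by_contra! hlt
    have hpos : 0 < (f m).re := by simpa using hlt
    have := hfu ((u / (f m).re) • m) (smul_nonneg (by positivity) hm)
    rw [← Complex.coe_smul, map_smul] at this
    simp [hpos.ne'] at this
  obtain ⟨φ, hφ, hφre⟩ := exists_positive_functional_re_eq_s5 (-f) hf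
  have h1 := h φ hφ
  rw [hφre x hx] at h1
  simp at h1 hux
  linarith

/-- A noncommutative Dini theorem: a decreasing net of positive elements which no positive
functional bounds away from zero converges to zero in norm. -/
lemma tendsto_zero_of_antitone_of_forall_positive_functional {ι : Type*} [Preorder ι]
    [IsDirected ι (· ≤ ·)] [Nonempty ι] {c : ι → B} (hc : ∀ i, 0 ≤ c i) (hanti : Antitone c)
    (h : ∀ φ : B →L[ℂ] ℂ, (∀ m, 0 ≤ m → 0 ≤ φ m) → ∀ ε > 0, ∃ i, (φ (c i)).re < ε) :
    Tendsto c atTop (𝓝 0) := by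
  rw [tendsto_zero_iff_norm_tendsto_zero, NormedAddGroup.tendsto_nhds_zero]
  intro ε hε
  suffices ∃ i, ‖c i‖ < ε by
    obtain ⟨i, hi⟩ := this
    filter_upwards [eventually_ge_atTop i] with j hj
    rw [norm_norm]
    exact (CStarAlgebra.norm_le_norm_of_nonneg_of_le (hc j) (hanti hj)).trans_lt hi
  by_contra! hge
  have hconv : Convex ℝ {y : B | ∃ i, c i ≤ y} := by
    rintro y ⟨i, hi⟩ z ⟨j, hj⟩ s t hs ht hst
    obtain ⟨k, hik, hjk⟩ := exists_ge_ge i j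
    refine ⟨k, ?_⟩
    exact (convex_Ici (c k)) ((hanti hik).trans hi) ((hanti hjk).trans hj) hs ht hst
  have hdisj : Disjoint (Metric.ball (0 : B) ε) {y : B | ∃ i, c i ≤ y} := by
    rw [Set.disjoint_left]
    rintro y hy ⟨i, hi⟩
    rw [mem_ball_zero_iff] at hy
    exact ((hge i).trans (CStarAlgebra.norm_le_norm_of_nonneg_of_le (hc i) hi)).not_gt hy
  obtain ⟨f, u, hball, hfu⟩ := RCLike.geometric_hahn_banach_open (𝕜 := ℂ)
    (convex_ball (0 : B) ε) Metric.isOpen_ball hconv hdisj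
  have hu : 0 < u := by simpa using hball 0 (Metric.mem_ball_self hε)
  obtain ⟨i₀⟩ := ‹Nonempty ι›
  have hf (m : B) (hm : 0 ≤ m) : 0 ≤ (f m).re := by
    by_contra! hlt
    have h0 : u ≤ (f (c i₀)).re := hfu _ ⟨i₀, le_rfl⟩
    have hpos : 0 < -(f m).re := by linarith
    have := hfu (c i₀ + ((f (c i₀)).re / -(f m).re) • m)
      ⟨i₀, le_add_of_nonneg_right (smul_nonneg (div_nonneg (by linarith) hpos.le) hm)⟩
    rw [← Complex.coe_smul, map_add, map_smul] at this
    simp [div_neg, hlt.ne] at this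
    linarith
  obtain ⟨φ, hφ, hφre⟩ := exists_positive_functional_re_eq_s5 f hf
  obtain ⟨i, hi⟩ := h φ hφ u hu
  rw [hφre _ (IsSelfAdjoint.of_nonneg (hc i))] at hi
  have h1 : u ≤ (f (c i)).re := hfu _ ⟨i, le_rfl⟩
  linarith

lemma norm_mul_sq_le_of_nonneg {x : B} (hx : 0 ≤ x) (b : B) :
    ‖x * b‖ ^ 2 ≤ ‖x‖ * ‖star b * x * b‖ := by
  set s := CFC.sqrt x
  have hs : star s = s := (IsSelfAdjoint.of_nonneg (CFC.sqrt_nonneg x)).star_eq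
  have hss : s * s = x := CFC.sqrt_mul_sqrt_self x
  have h1 : ‖x‖ = ‖s‖ * ‖s‖ := by rw [← CStarRing.norm_star_mul_self, hs, hss]
  have h2 : ‖star b * x * b‖ = ‖s * b‖ * ‖s * b‖ := by
    rw [← CStarRing.norm_star_mul_self, star_mul, hs, ← hss]
    simp only [mul_assoc]
  have h3 : ‖x * b‖ ≤ ‖s‖ * ‖s * b‖ := by
    rw [← hss, mul_assoc]
    exact norm_mul_le _ _
  calc ‖x * b‖ ^ 2 ≤ (‖s‖ * ‖s * b‖) ^ 2 := by gcongr
    _ = ‖x‖ * ‖star b * x * b‖ := by rw [h1, h2]; ring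

end CStarAlgebra

namespace DoubleCentralizer

variable {A : Type*} [NonUnitalCStarAlgebra A]

lemma norm_coe (b : A) : ‖(b : 𝓜(ℂ, A))‖ = ‖b‖ := by
  rw [← norm_fst, coe_fst, ContinuousLinearMap.opNorm_mul_apply]

lemma mul_coe (m : 𝓜(ℂ, A)) (b : A) :
    m * (b : 𝓜(ℂ, A)) = ((m.fst b : A) : 𝓜(ℂ, A)) := by
  rw [← sub_eq_zero, ← norm_eq_zero, ← norm_snd, norm_eq_zero]
  ext c
  simp [m.central]

lemma norm_fst_apply (m : 𝓜(ℂ, A)) (b : A) : ‖m.fst b‖ = ‖m * (b : 𝓜(ℂ, A))‖ := by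
  rw [mul_coe, norm_coe]

lemma eq_zero_of_forall_mul_coe {m : 𝓜(ℂ, A)} (h : ∀ b : A, m * (b : 𝓜(ℂ, A)) = 0) : m = 0 := by
  rw [← norm_eq_zero, ← norm_fst, norm_eq_zero]
  ext b
  simp [← norm_eq_zero, norm_fst_apply, h b]

lemma continuous_strictTopology_fst_apply (b : A) :
    Continuous[strictTopology A, inferInstance] fun m : 𝓜(ℂ, A) => m.fst b :=
  continuous_iff_le_induced.mpr ((iInf_le _ b).trans inf_le_left)

lemma continuous_strictTopology_star_coe_mul_mul_coe (b : A) :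
    Continuous[strictTopology A, inferInstance]
      fun m : 𝓜(ℂ, A) => star (b : 𝓜(ℂ, A)) * m * (b : 𝓜(ℂ, A)) := by
  have hcoe : Continuous fun x : A => star (b : 𝓜(ℂ, A)) * (x : 𝓜(ℂ, A)) :=
    continuous_const.mul (AddMonoidHomClass.isometry_of_norm (coeHom (𝕜 := ℂ) (A := A))
      norm_coe).continuous
  have heq (m : 𝓜(ℂ, A)) : star (b : 𝓜(ℂ, A)) * m * (b : 𝓜(ℂ, A)) =
      star (b : 𝓜(ℂ, A)) * ((m.fst b : A) : 𝓜(ℂ, A)) := by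
    rw [mul_assoc, mul_coe]
  simp only [heq]
  exact @Continuous.comp _ _ _ (strictTopology A) _ _ _
    (fun x : A => star (b : 𝓜(ℂ, A)) * (x : 𝓜(ℂ, A))) hcoe (continuous_strictTopology_fst_apply b)

variable [PartialOrder 𝓜(ℂ, A)] [StarOrderedRing 𝓜(ℂ, A)]

/-- Positivity of a self-adjoint multiplier can be tested after compression by elements of the
algebra. -/
lemma nonneg_of_forall_star_coe_mul_mul_coe {x : 𝓜(ℂ, A)} (hx : IsSelfAdjoint x)
    (h : ∀ b : A, 0 ≤ star (b : 𝓜(ℂ, A)) * x * (b : 𝓜(ℂ, A))) : 0 ≤ x := by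
  rw [← CFC.negPart_eq_zero_iff x]
  set y := x⁻
  have hy : 0 ≤ y := CFC.negPart_nonneg x
  have hys : star y = y := (IsSelfAdjoint.of_nonneg hy).star_eq
  have hyx : y * x = -(y * y) := by
    conv_lhs => rw [← CFC.posPart_sub_negPart x]
    rw [mul_sub, CFC.negPart_mul_posPart, zero_sub]
  refine eq_zero_of_forall_mul_coe fun b => ?_
  have hcomp : star (y * (b : 𝓜(ℂ, A))) * y * (y * (b : 𝓜(ℂ, A))) = 0 := by
    refine le_antisymm ?_ (star_left_conjugate_nonneg hy _)
    have h1 := h (y.fst b)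
    rw [← mul_coe, star_mul, hys, mul_assoc _ y x, hyx] at h1
    rw [star_mul, hys, ← neg_nonneg]
    convert h1 using 1
    noncomm_ring
  have h2 := norm_mul_sq_le_of_nonneg hy (y * (b : 𝓜(ℂ, A)))
  rw [hcomp, norm_zero, mul_zero] at h2
  have h3 : y * (y * (b : 𝓜(ℂ, A))) = 0 := by
    rw [← norm_eq_zero]
    exact pow_eq_zero_iff two_ne_zero |>.mp (le_antisymm h2 (sq_nonneg _))
  rw [← CStarRing.star_mul_self_eq_zero_iff, star_mul, hys, mul_assoc, h3, mul_zero]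

end DoubleCentralizer

open DoubleCentralizer

/-- If `(a_i)` is an increasing net of positive elements of `M(A)`, `a` is a positive element
of `M(A)`, and for every strictly continuous positive linear functional `ω` on `M(A)` the
value `ω(a)` is the supremum of the values `ω(a_i)`, then `(a_i)` converges strictly to `a`. -/
theorem strict_tendsto_of_forall_strictly_continuous_positive_functional_isLUB
    {A : Type*} [NonUnitalCStarAlgebra A]
    [PartialOrder 𝓜(ℂ, A)] [StarOrderedRing 𝓜(ℂ, A)]
    {ι : Type*} [Preorder ι] [IsDirected ι (· ≤ ·)] [Nonempty ι]
    (a : ι → 𝓜(ℂ, A)) (hpos : ∀ i, 0 ≤ a i) (hmono : Monotone a)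
    (a₀ : 𝓜(ℂ, A)) (ha₀ : 0 ≤ a₀)
    (h : ∀ ω : 𝓜(ℂ, A) →ₗ[ℂ] ℂ,
      Continuous[strictTopology A, inferInstance] ω →
      (∀ m : 𝓜(ℂ, A), 0 ≤ m → 0 ≤ ω m) →
      IsLUB (Set.range fun i => (ω (a i)).re) (ω a₀).re) :
    ∀ b : A, Tendsto (fun i => (a i).fst b) atTop (𝓝 (a₀.fst b)) ∧
      Tendsto (fun i => (a i).snd b) atTop (𝓝 (a₀.snd b)) := by
  have hω (b : A) (φ : 𝓜(ℂ, A) →L[ℂ] ℂ) (hφ : ∀ m, 0 ≤ m → 0 ≤ φ m) :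
      IsLUB (Set.range fun i => (φ (star (b : 𝓜(ℂ, A)) * a i * (b : 𝓜(ℂ, A)))).re)
        (φ (star (b : 𝓜(ℂ, A)) * a₀ * (b : 𝓜(ℂ, A)))).re :=
    h (φ.toLinearMap ∘ₗ LinearMap.mulLeftRight ℂ (star (b : 𝓜(ℂ, A)), (b : 𝓜(ℂ, A))))
      (@Continuous.comp _ _ _ (strictTopology A) _ _ _ φ φ.continuous
        (continuous_strictTopology_star_coe_mul_mul_coe b))
      fun m hm => hφ _ (star_left_conjugate_nonneg hm _)
  have hsa (i) : IsSelfAdjoint (a₀ - a i) :=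
    (IsSelfAdjoint.of_nonneg ha₀).sub (IsSelfAdjoint.of_nonneg (hpos i))
  have hnonneg (i) : 0 ≤ a₀ - a i := by
    refine nonneg_of_forall_star_coe_mul_mul_coe (hsa i) fun b => ?_
    refine nonneg_of_forall_positive_functional ((hsa i).conjugate' _) fun φ hφ => ?_
    rw [mul_sub, sub_mul, map_sub, Complex.sub_re, sub_nonneg]
    exact (hω b φ hφ).1 ⟨i, rfl⟩
  have hbound (i) : ‖a₀ - a i‖ ≤ ‖a₀‖ :=
    CStarAlgebra.norm_le_norm_of_nonneg_of_le (hnonneg i) (sub_le_self _ (hpos i))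
  have hfst (b : A) : Tendsto (fun i => (a i).fst b) atTop (𝓝 (a₀.fst b)) := by
    have hcomp : Tendsto (fun i => star (b : 𝓜(ℂ, A)) * (a₀ - a i) * (b : 𝓜(ℂ, A)))
        atTop (𝓝 0) := by
      refine tendsto_zero_of_antitone_of_forall_positive_functional
        (fun i => star_left_conjugate_nonneg (hnonneg i) _)
        (fun i j hij => star_left_conjugate_le_conjugate (sub_le_sub_left (hmono hij) _) _)
        fun φ hφ ε hε => ?_
      obtain ⟨_, ⟨i, rfl⟩, hi, -⟩ := (hω b φ hφ).exists_between (sub_lt_self _ hε)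
      refine ⟨i, ?_⟩
      rw [mul_sub, sub_mul, map_sub, Complex.sub_re]
      linarith
    have hsq : Tendsto (fun i => ‖(a₀ - a i).fst b‖ ^ 2) atTop (𝓝 0) := by
      refine squeeze_zero (fun i => sq_nonneg _) (fun i => ?_)
        (by simpa using hcomp.norm.const_mul ‖a₀‖)
      rw [norm_fst_apply]
      exact (norm_mul_sq_le_of_nonneg (hnonneg i) _).trans (by gcongr; exact hbound i)
    rw [tendsto_iff_norm_sub_tendsto_zero]
    simpa [norm_sub_rev] using hsq.sqrt
  refine fun b => ⟨hfst b, ?_⟩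
  have hsnd (m : 𝓜(ℂ, A)) (hm : 0 ≤ m) : m.snd b = star (m.fst (star b)) := by
    rw [← star_snd, (IsSelfAdjoint.of_nonneg hm).star_eq]
  simp only [hsnd a₀ ha₀, hsnd _ (hpos _)]
  exact (hfst (star b)).star
end

section
/- Let A be a C*-algebra, (X, μ) a measure space, and f : X → M(A) a function such that: (i) for every b ∈ A the maps t ↦ f(t)·b and t ↦ b·f(t) (taking values in A ⊆ M(A)) are Bochner μ-integrable; (ii) there exists a μ-integrable function g : X → ℝ with ‖f(t)‖ ≤ g(t) for all t ∈ X. Then there exists a unique element m ∈ M(A) such that for every b ∈ A one has m·b = ∫ f(t)·b dμ(t) and b·m = ∫ b·f(t) dμ(t) (Bochner integrals in the Banach space M(A), with values in the closed subspace A). -/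
open scoped MultiplierAlgebra
open MeasureTheory

/-- The pointwise integral of a dominated family of continuous linear maps, as a continuous
linear map. -/
theorem exists_continuousLinearMap_apply_eq_integral
    {𝕜 E F X : Type*} [RCLike 𝕜] [NormedAddCommGroup E] [NormedSpace 𝕜 E]
    [NormedAddCommGroup F] [NormedSpace 𝕜 F] [NormedSpace ℝ F]
    [MeasurableSpace X] {μ : Measure X} {T : X → E →L[𝕜] F}
    (hT : ∀ b, Integrable (fun t => T t b) μ)
    {g : X → ℝ} (hg : Integrable g μ) (hTg : ∀ t, ‖T t‖ ≤ g t) :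
    ∃ S : E →L[𝕜] F, ∀ b, S b = ∫ t, T t b ∂μ := by
  refine ⟨LinearMap.mkContinuous
    { toFun := fun b => ∫ t, T t b ∂μ
      map_add' := fun a b => by
        simp only [map_add]
        exact integral_add (hT a) (hT b)
      map_smul' := fun c b => by
        simp only [map_smul, RingHom.id_apply]
        exact integral_smul c _ } (∫ t, g t ∂μ) fun b => ?_, fun b => rfl⟩
  calc ‖∫ t, T t b ∂μ‖ ≤ ∫ t, g t * ‖b‖ ∂μ :=
        norm_integral_le_of_norm_le (hg.mul_const _) <| .of_forall fun t =>
          (T t).le_of_opNorm_le (hTg t) b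
    _ = (∫ t, g t ∂μ) * ‖b‖ := integral_mul_const _ _

/-- Existence and uniqueness of the strict integral: if `f : X → M(A)` is such that all the
`A`-valued functions `t ↦ f(t)·b` and `t ↦ b·f(t)` are Bochner integrable and `‖f‖` is
dominated by an integrable function, then there is a unique multiplier `m ∈ M(A)` with
`m·b = ∫ f(t)·b dμ` and `b·m = ∫ b·f(t) dμ` for all `b ∈ A`.
Here `m.fst b` is `m·b` and `m.snd b` is `b·m`. -/
theorem exists_unique_strict_integral
    {A : Type*} [NonUnitalCStarAlgebra A]
    {X : Type*} [MeasurableSpace X] (μ : Measure X)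
    (f : X → 𝓜(ℂ, A))
    (hint : ∀ b : A, Integrable (fun t => (f t).fst b) μ ∧
      Integrable (fun t => (f t).snd b) μ)
    (g : X → ℝ) (hg : Integrable g μ) (hfg : ∀ t, ‖f t‖ ≤ g t) :
    ∃! m : 𝓜(ℂ, A), ∀ b : A,
      m.fst b = ∫ t, (f t).fst b ∂μ ∧ m.snd b = ∫ t, (f t).snd b ∂μ := by
  obtain ⟨L, hL⟩ := exists_continuousLinearMap_apply_eq_integral (fun b => (hint b).1) hg
    fun t => (DoubleCentralizer.norm_fst (f t)).trans_le (hfg t)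
  obtain ⟨R, hR⟩ := exists_continuousLinearMap_apply_eq_integral (fun b => (hint b).2) hg
    fun t => (DoubleCentralizer.norm_snd (f t)).trans_le (hfg t)
  refine ⟨⟨(L, R), fun x y => ?_⟩, fun b => ⟨hL b, hR b⟩, fun m hm => ?_⟩
  · change R x * y = x * L y
    have h₁ := (ContinuousLinearMap.mul ℂ A x).integral_comp_comm (hint y).1
    have h₂ := ((ContinuousLinearMap.mul ℂ A).flip y).integral_comp_comm (hint x).2
    simp only [ContinuousLinearMap.mul_apply', ContinuousLinearMap.flip_apply] at h₁ h₂
    rw [hL, hR, ← h₁, ← h₂]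
    exact integral_congr_ae (.of_forall fun t => (f t).central x y)
  · refine DoubleCentralizer.ext ℂ A _ _ (Prod.ext ?_ ?_)
    · exact ContinuousLinearMap.ext fun b => (hm b).1.trans (hL b).symm
    · exact ContinuousLinearMap.ext fun b => (hm b).2.trans (hR b).symm
end

section
/- Let A and B be C*-algebras and let π be a strictly closed linear map from a subspace D(π) ⊆ M(A) into M(B), i.e., the graph of π is closed in M(A) × M(B) when both multiplier algebras carry their strict topologies. Let (X, μ) be a measure space and f : X → M(A) a function with f(t) ∈ D(π) for all t, and suppose there is a μ-integrable function g : X → ℝ with ‖f(t)‖ ≤ g(t) and ‖π(f(t))‖ ≤ g(t) for all t ∈ X, and that for every a ∈ A the maps t ↦ f(t)·a, t ↦ a·f(t) are Bochner μ-integrable and for every b ∈ B the maps t ↦ π(f(t))·b, t ↦ b·π(f(t)) are Bochner μ-integrable. If m ∈ M(A) satisfies m·a = ∫ f(t)·a dμ(t) and a·m = ∫ a·f(t) dμ(t) for all a ∈ A, and n ∈ M(B) satisfies n·b = ∫ π(f(t))·b dμ(t) and b·n = ∫ b·π(f(t)) dμ(t) for all b ∈ B, then m ∈ D(π) and π(m)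 = n. -/
open scoped MultiplierAlgebra
open MeasureTheory

/-- The integral of a function with values in a closed subspace lies in that subspace. -/
theorem Submodule.integral_mem_of_isClosed {𝕜 E X : Type*} [RCLike 𝕜] [NormedAddCommGroup E]
    [NormedSpace ℝ E] [NormedSpace 𝕜 E] [IsScalarTower ℝ 𝕜 E] [CompleteSpace E]
    [MeasurableSpace X] {μ : Measure X} {S : Submodule 𝕜 E} (hS : IsClosed (S : Set E))
    {h : X → E} (hh : ∀ t, h t ∈ S) (hint : Integrable h μ) : ∫ t, h t ∂μ ∈ S := by
  let T : Submodule ℝ E := S.restrictScalars ℝ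
  have hT : IsClosed (T : Set E) := hS
  have key := T.mkQL.integral_comp_comm hint
  have hzero : ∀ t, T.mkQL (h t) = 0 := fun t => (Submodule.Quotient.mk_eq_zero T).2 (hh t)
  simp only [hzero, integral_zero] at key
  exact (Submodule.Quotient.mk_eq_zero T).1 key.symm

/-- The coordinatewise integral of a function with values in a subspace of a power of a Banach
space lies in the closure of that subspace for the product topology. -/
theorem Submodule.pi_integral_mem_closure {𝕜 ι E X : Type*} [RCLike 𝕜] [NormedAddCommGroup E]
    [NormedSpace ℝ E] [NormedSpace 𝕜 E] [IsScalarTower ℝ 𝕜 E] [CompleteSpace E]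
    [MeasurableSpace X] {μ : Measure X} (S : Submodule 𝕜 (ι → E)) {h : X → ι → E}
    (hh : ∀ t, h t ∈ S) (hint : ∀ i, Integrable (fun t => h t i) μ) :
    (fun i => ∫ t, h t i ∂μ) ∈ closure (S : Set (ι → E)) := by
  rw [mem_closure_iff_nhds]
  intro U hU
  rw [nhds_pi, Filter.mem_pi'] at hU
  obtain ⟨I, V, hV, hVU⟩ := hU
  let R : (ι → E) →ₗ[𝕜] (I → E) := LinearMap.funLeft 𝕜 E Subtype.val
  have hR : Integrable (fun t => R (h t)) μ := Integrable.of_eval fun i => hint i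
  have hmem := Submodule.integral_mem_of_isClosed (S.map R).isClosed_topologicalClosure
    (fun t => (S.map R).le_topologicalClosure (Submodule.mem_map_of_mem (hh t))) hR
  have hopen : Set.univ.pi (fun i : I => V i) ∈ nhds (∫ t, R (h t) ∂μ) := by
    refine set_pi_mem_nhds Set.finite_univ fun i _ => ?_
    rw [eval_integral (f := fun t => R (h t)) fun i => hint i]
    exact hV i
  obtain ⟨_, hy, x, hx, rfl⟩ := mem_closure_iff_nhds.1 hmem _ hopen
  exact ⟨x, hVU fun i hi => hy ⟨i, hi⟩ trivial, hx⟩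

/-- The evaluations of a pair of multipliers that determine the product of the strict topologies,
as one linear map. -/
noncomputable def strictEval (A B : Type*) [NonUnitalCStarAlgebra A] [NonUnitalCStarAlgebra B] :
    𝓜(ℂ, A) × 𝓜(ℂ, B) →ₗ[ℂ] A × B → (A × A) × (B × B) where
  toFun p c := ((p.1.fst c.1, p.1.snd c.1), (p.2.fst c.2, p.2.snd c.2))
  map_add' _ _ := rfl
  map_smul' _ _ := rfl

theorem induced_strictEval_le (A B : Type*) [NonUnitalCStarAlgebra A] [NonUnitalCStarAlgebra B] :
    TopologicalSpace.induced (strictEval A B) inferInstance ≤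
      @instTopologicalSpaceProd _ _ (strictTopology A) (strictTopology B) := by
  let τ : TopologicalSpace (𝓜(ℂ, A) × 𝓜(ℂ, B)) :=
    TopologicalSpace.induced (strictEval A B) inferInstance
  have hcont : ∀ c, Continuous fun p => strictEval A B p c := fun c =>
    (continuous_apply c).comp continuous_induced_dom
  refine le_inf (continuous_iff_le_induced.1 ?_) (continuous_iff_le_induced.1 ?_)
  · refine continuous_iInf_rng.2 fun a => continuous_inf_rng.2
      ⟨continuous_induced_rng.2 ?_, continuous_induced_rng.2 ?_⟩
    · exact (hcont (a, 0)).fst.fst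
    · exact (hcont (a, 0)).fst.snd
  · refine continuous_iInf_rng.2 fun b => continuous_inf_rng.2
      ⟨continuous_induced_rng.2 ?_, continuous_induced_rng.2 ?_⟩
    · exact (hcont (0, b)).snd.fst
    · exact (hcont (0, b)).snd.snd

/-- A strictly closed linear map `π : D(π) ⊆ M(A) → M(B)` commutes with strict integrals:
if `f : X → D(π)` with `‖f‖, ‖π ∘ f‖` dominated by an integrable function and all the relevant
`A`- and `B`-valued functions are Bochner integrable, and if `m` and `n` are the strict
integrals of `f` and `π ∘ f` respectively, then `m ∈ D(π)` and `π(m) = n`. -/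
theorem strictly_closed_map_comm_strict_integral
    {A B : Type*} [NonUnitalCStarAlgebra A] [NonUnitalCStarAlgebra B]
    (D : Submodule ℂ 𝓜(ℂ, A)) (π : D →ₗ[ℂ] 𝓜(ℂ, B))
    (hgraph : @IsClosed (𝓜(ℂ, A) × 𝓜(ℂ, B))
      (@instTopologicalSpaceProd _ _ (strictTopology A) (strictTopology B))
      {p : 𝓜(ℂ, A) × 𝓜(ℂ, B) | ∃ h : p.1 ∈ D, π ⟨p.1, h⟩ = p.2})
    {X : Type*} [MeasurableSpace X] (μ : Measure X)
    (f : X → 𝓜(ℂ, A)) (hf : ∀ t, f t ∈ D)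
    (g : X → ℝ) (hg : Integrable g μ)
    (hfg : ∀ t, ‖f t‖ ≤ g t) (hπfg : ∀ t, ‖π ⟨f t, hf t⟩‖ ≤ g t)
    (hfint : ∀ a : A, Integrable (fun t => (f t).fst a) μ ∧
      Integrable (fun t => (f t).snd a) μ)
    (hπfint : ∀ b : B, Integrable (fun t => (π ⟨f t, hf t⟩).fst b) μ ∧
      Integrable (fun t => (π ⟨f t, hf t⟩).snd b) μ)
    (m : 𝓜(ℂ, A))
    (hm : ∀ a : A, m.fst a = ∫ t, (f t).fst a ∂μ ∧ m.snd a = ∫ t, (f t).snd a ∂μ)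
    (n : 𝓜(ℂ, B))
    (hn : ∀ b : B, n.fst b = ∫ t, (π ⟨f t, hf t⟩).fst b ∂μ ∧
      n.snd b = ∫ t, (π ⟨f t, hf t⟩).snd b ∂μ) :
    ∃ h : m ∈ D, π ⟨m, h⟩ = n := by
  let G : Submodule ℂ (𝓜(ℂ, A) × 𝓜(ℂ, B)) := LinearPMap.graph ⟨D, π⟩
  have hG : ∀ p, p ∈ G ↔ ∃ h : p.1 ∈ D, π ⟨p.1, h⟩ = p.2 := fun p => by
    refine (LinearPMap.mem_graph_iff' (⟨D, π⟩ : 𝓜(ℂ, A) →ₗ.[ℂ] 𝓜(ℂ, B))).trans ⟨?_, fun ⟨h, hp⟩ => ⟨⟨p.1, h⟩, Prod.ext rfl hp⟩⟩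
    rintro ⟨y, rfl⟩
    exact ⟨y.2, rfl⟩
  let F : X → 𝓜(ℂ, A) × 𝓜(ℂ, B) := fun t => (f t, π ⟨f t, hf t⟩)
  have hint : ∀ c, Integrable (fun t => strictEval A B (F t) c) μ := fun c =>
    ((hfint c.1).1.prodMk (hfint c.1).2).prodMk ((hπfint c.2).1.prodMk (hπfint c.2).2)
  have heval : strictEval A B (m, n) = fun c => ∫ t, strictEval A B (F t) c ∂μ := by
    funext c
    refine Eq.symm ((integral_pair ((hfint c.1).1.prodMk (hfint c.1).2)
      ((hπfint c.2).1.prodMk (hπfint c.2).2)).trans ?_)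
    rw [integral_pair (hfint c.1).1 (hfint c.1).2, integral_pair (hπfint c.2).1 (hπfint c.2).2,
      ← (hm c.1).1, ← (hm c.1).2, ← (hn c.2).1, ← (hn c.2).2]
    rfl
  have hmem := Submodule.pi_integral_mem_closure (G.map (strictEval A B))
    (fun t => Submodule.mem_map_of_mem ((hG (F t)).2 ⟨hf t, rfl⟩)) hint
  rw [← heval, Submodule.map_coe] at hmem
  have hclosed := hgraph.mono (induced_strictEval_le A B)
  have hgraph_eq : (G : Set (𝓜(ℂ, A) × 𝓜(ℂ, B))) =
      {p | ∃ h : p.1 ∈ D, π ⟨p.1, h⟩ = p.2} := Set.ext hG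
  rw [hgraph_eq] at hmem
  let _ : TopologicalSpace (𝓜(ℂ, A) × 𝓜(ℂ, B)) :=
    TopologicalSpace.induced (strictEval A B) inferInstance
  have := closure_induced.2 hmem
  rwa [hclosed.closure_eq] at this
end

section
/- Let A be a C*-algebra, H a Hilbert space, and Λ a linear map from a subspace D(Λ) ⊆ M(A) into H whose graph is closed in M(A) × H, where M(A) carries the strict topology and H the norm topology. Let (X, μ) be a measure space and f : X → M(A) a function with f(t) ∈ D(Λ) for all t, and suppose there is a μ-integrable function g : X → ℝ with ‖f(t)‖ ≤ g(t) and ‖Λ(f(t))‖ ≤ g(t) for all t ∈ X, that for every a ∈ A the maps t ↦ f(t)·a and t ↦ a·f(t) are Bochner μ-integrable, and that t ↦ Λ(f(t)) is Bochner μ-integrable in H. If m ∈ M(A) satisfies m·a = ∫ f(t)·a dμ(t) and a·m = ∫ a·f(t) dμ(t) for all a ∈ A, then m ∈ D(Λ) and Λ(m) = ∫ Λ(f(t)) dμ(t). -/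
open scoped MultiplierAlgebra
open MeasureTheory

/-- A Bochner integral of a function with values in a subspace lies in the closure of that
subspace. -/
theorem Submodule.integral_mem_topologicalClosure {E : Type*} [NormedAddCommGroup E]
    [NormedSpace ℂ E] [CompleteSpace E] (K : Submodule ℂ E)
    {X : Type*} [MeasurableSpace X] {μ : Measure X} {F : X → E}
    (hF : Integrable F μ) (hK : ∀ t, F t ∈ K) : ∫ t, F t ∂μ ∈ K.topologicalClosure := by
  let L := K.topologicalClosure
  have : IsClosed (L : Set E) := K.isClosed_topologicalClosure
  have hzero : L.mkQL (∫ t, F t ∂μ) = 0 := by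
    rw [← L.mkQL.integral_comp_comm hF]
    have h : ∀ t, L.mkQL (F t) = 0 := fun t =>
      (Submodule.Quotient.mk_eq_zero L).2 (K.le_topologicalClosure (hK t))
    simp [h]
  exact (Submodule.Quotient.mk_eq_zero L).1 hzero

/-- Convergence in the strict topology is pointwise norm convergence of both components. -/
theorem tendsto_strictTopology {A : Type*} [NonUnitalCStarAlgebra A] {ι : Type*} {l : Filter ι}
    {u : ι → 𝓜(ℂ, A)} {m : 𝓜(ℂ, A)}
    (h : ∀ a : A, Filter.Tendsto (fun i => (u i).fst a) l (nhds (m.fst a)) ∧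
      Filter.Tendsto (fun i => (u i).snd a) l (nhds (m.snd a))) :
    Filter.Tendsto u l (@nhds _ (strictTopology A) m) := by
  rw [strictTopology, nhds_iInf, Filter.tendsto_iInf]
  intro a
  refine Filter.Tendsto.mono_right (Filter.tendsto_inf.2 ⟨?_, ?_⟩) <|
    (nhds_inf (t₁ := .induced (fun m : 𝓜(ℂ, A) => m.fst a) inferInstance)
      (t₂ := .induced (fun m : 𝓜(ℂ, A) => m.snd a) inferInstance) (a := m)).ge
  · rw [nhds_induced, Filter.tendsto_comap_iff]
    exact (h a).1
  · rw [nhds_induced, Filter.tendsto_comap_iff]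
    exact (h a).2

/-- The map `d ↦ ((d·a)_{a ∈ S}, (a·d)_{a ∈ S}, Λ d)` on the domain of `Λ`. -/
noncomputable def strictEvalMap {A : Type*} [NonUnitalCStarAlgebra A]
    {H : Type*} [NormedAddCommGroup H] [InnerProductSpace ℂ H]
    {D : Submodule ℂ 𝓜(ℂ, A)} (Λ : D →ₗ[ℂ] H) (S : Finset A) :
    D →ₗ[ℂ] (S → A) × (S → A) × H where
  toFun d := (fun a => (d : 𝓜(ℂ, A)).fst a, fun a => (d : 𝓜(ℂ, A)).snd a, Λ d)
  map_add' x y := by ext <;> simp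
  map_smul' c x := by ext <;> simp

/-- On finitely many elements of `A`, the strict integral of `f` and the integral of `Λ ∘ f` are
simultaneously approximated by elements of the graph of `Λ`. -/
theorem exists_approx_strict_integral
    {A : Type*} [NonUnitalCStarAlgebra A]
    {H : Type*} [NormedAddCommGroup H] [InnerProductSpace ℂ H] [CompleteSpace H]
    {D : Submodule ℂ 𝓜(ℂ, A)} (Λ : D →ₗ[ℂ] H)
    {X : Type*} [MeasurableSpace X] {μ : Measure X} (f : X → D)
    (hfint : ∀ a : A, Integrable (fun t => (f t : 𝓜(ℂ, A)).fst a) μ ∧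
      Integrable (fun t => (f t : 𝓜(ℂ, A)).snd a) μ)
    (hΛfint : Integrable (fun t => Λ (f t)) μ) (S : Finset A) {ε : ℝ} (hε : 0 < ε) :
    ∃ d : D, (∀ a ∈ S, dist ((d : 𝓜(ℂ, A)).fst a) (∫ t, (f t : 𝓜(ℂ, A)).fst a ∂μ) < ε ∧
      dist ((d : 𝓜(ℂ, A)).snd a) (∫ t, (f t : 𝓜(ℂ, A)).snd a ∂μ) < ε) ∧
      dist (Λ d) (∫ t, Λ (f t) ∂μ) < ε := by
  have hfst : Integrable (fun t => fun a : S => (f t : 𝓜(ℂ, A)).fst (a : A)) μ :=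
    Integrable.of_eval fun a => (hfint a).1
  have hsnd : Integrable (fun t => fun a : S => (f t : 𝓜(ℂ, A)).snd (a : A)) μ :=
    Integrable.of_eval fun a => (hfint a).2
  have hF : Integrable (fun t => strictEvalMap Λ S (f t)) μ :=
    hfst.prodMk (hsnd.prodMk hΛfint)
  have hint : ∫ t, strictEvalMap Λ S (f t) ∂μ =
      (fun a : S => ∫ t, (f t : 𝓜(ℂ, A)).fst (a : A) ∂μ,
        fun a : S => ∫ t, (f t : 𝓜(ℂ, A)).snd (a : A) ∂μ, ∫ t, Λ (f t) ∂μ) := by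
    refine (integral_pair hfst (hsnd.prodMk hΛfint)).trans ?_
    rw [integral_pair hsnd hΛfint]
    congr 1
    · exact funext fun a => eval_integral (fun b : S => (hfint b).1) a
    · congr 1
      exact funext fun a => eval_integral (fun b : S => (hfint b).2) a
  have hmem := Submodule.integral_mem_topologicalClosure (LinearMap.range (strictEvalMap Λ S))
    hF fun t => ⟨f t, rfl⟩
  rw [hint] at hmem
  obtain ⟨_, ⟨d, rfl⟩, hd⟩ := Metric.mem_closure_iff.1 hmem ε hε
  rw [dist_comm, Prod.dist_eq, max_lt_iff, Prod.dist_eq, max_lt_iff, dist_pi_lt_iff hε,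
    dist_pi_lt_iff hε] at hd
  exact ⟨d, fun a ha => ⟨hd.1 ⟨a, ha⟩, hd.2.1 ⟨a, ha⟩⟩, hd.2.2⟩

/-- A linear map `Λ : D(Λ) ⊆ M(A) → H` whose graph is strict×norm closed commutes with strict
integrals: if `f : X → D(Λ)` with `‖f‖, ‖Λ ∘ f‖` dominated by an integrable function, the
`A`-valued functions `t ↦ f(t)·a`, `t ↦ a·f(t)` are Bochner integrable, `Λ ∘ f` is Bochner
integrable, and `m` is the strict integral of `f`, then `m ∈ D(Λ)` and `Λ(m) = ∫ Λ(f(t)) dμ`. -/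
theorem strictly_closed_gns_map_comm_strict_integral
    {A : Type*} [NonUnitalCStarAlgebra A]
    {H : Type*} [NormedAddCommGroup H] [InnerProductSpace ℂ H] [CompleteSpace H]
    (D : Submodule ℂ 𝓜(ℂ, A)) (Λ : D →ₗ[ℂ] H)
    (hgraph : @IsClosed (𝓜(ℂ, A) × H)
      (@instTopologicalSpaceProd _ _ (strictTopology A) inferInstance)
      {p : 𝓜(ℂ, A) × H | ∃ h : p.1 ∈ D, Λ ⟨p.1, h⟩ = p.2})
    {X : Type*} [MeasurableSpace X] (μ : Measure X)
    (f : X → 𝓜(ℂ, A)) (hf : ∀ t, f t ∈ D)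
    (g : X → ℝ) (hg : Integrable g μ)
    (hfg : ∀ t, ‖f t‖ ≤ g t) (hΛfg : ∀ t, ‖Λ ⟨f t, hf t⟩‖ ≤ g t)
    (hfint : ∀ a : A, Integrable (fun t => (f t).fst a) μ ∧
      Integrable (fun t => (f t).snd a) μ)
    (hΛfint : Integrable (fun t => Λ ⟨f t, hf t⟩) μ)
    (m : 𝓜(ℂ, A))
    (hm : ∀ a : A, m.fst a = ∫ t, (f t).fst a ∂μ ∧ m.snd a = ∫ t, (f t).snd a ∂μ) :
    ∃ h : m ∈ D, Λ ⟨m, h⟩ = ∫ t, Λ ⟨f t, hf t⟩ ∂μ := by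
  classical
  choose d hd hdΛ using fun p : Finset A × ℕ =>
    exists_approx_strict_integral Λ (fun t => ⟨f t, hf t⟩) hfint hΛfint p.1
      (Nat.one_div_pos_of_nat (α := ℝ) (n := p.2))
  have hlim : Filter.Tendsto (fun p : Finset A × ℕ => 1 / ((p.2 : ℝ) + 1)) Filter.atTop
      (nhds 0) := by
    rw [← Filter.prod_atTop_atTop_eq]
    exact tendsto_one_div_add_atTop_nhds_zero_nat.comp Filter.tendsto_snd
  have hev : ∀ a : A, ∀ᶠ p : Finset A × ℕ in Filter.atTop, a ∈ p.1 := fun a =>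
    (Filter.eventually_ge_atTop (({a}, 0) : Finset A × ℕ)).mono fun p hp =>
      hp.1 (Finset.mem_singleton_self a)
  have hstrict : Filter.Tendsto (fun p => (d p : 𝓜(ℂ, A))) Filter.atTop
      (@nhds _ (strictTopology A) m) := by
    refine tendsto_strictTopology fun a => ?_
    rw [(hm a).1, (hm a).2]
    exact ⟨tendsto_iff_dist_tendsto_zero.2 <| squeeze_zero' (.of_forall fun _ => dist_nonneg)
        ((hev a).mono fun p hp => (hd p a hp).1.le) hlim,
      tendsto_iff_dist_tendsto_zero.2 <| squeeze_zero' (.of_forall fun _ => dist_nonneg)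
        ((hev a).mono fun p hp => (hd p a hp).2.le) hlim⟩
  have hΛlim : Filter.Tendsto (fun p => Λ (d p)) Filter.atTop
      (nhds (∫ t, Λ ⟨f t, hf t⟩ ∂μ)) :=
    tendsto_iff_dist_tendsto_zero.2
      (squeeze_zero (fun _ => dist_nonneg) (fun p => (hdΛ p).le) hlim)
  have hpair := @Filter.Tendsto.prodMk_nhds _ _ (strictTopology A) _ _ _ _ _ _ _ hstrict hΛlim
  exact @IsClosed.mem_of_tendsto _ (@instTopologicalSpaceProd _ _ (strictTopology A) _)
    (Finset A × ℕ) (m, ∫ t, Λ ⟨f t, hf t⟩ ∂μ) _ (fun p => ((d p : 𝓜(ℂ, A)), Λ (d p)))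
    _ _ hgraph hpair (.of_forall fun p => ⟨(d p).2, rfl⟩)
end

section
/- Let E be a normed space, H a Hilbert space, and Λ a linear map from a linear subspace D(Λ) ⊆ E into H. Let (x_i)_{i∈I} be a net in D(Λ) (with I a nonempty directed set) and x ∈ E such that (x_i)_{i∈I} converges to x in norm and the family (Λ(x_i))_{i∈I} is bounded in H. Then there exist an element v ∈ H and a sequence (y_n)_{n≥1} of elements of the convex hull of {x_i : i ∈ I} (so in particular y_n ∈ D(Λ)) such that (y_n) converges to x in norm and (Λ(y_n)) converges to v in H. -/
open Filter Topology

/-- A decreasing sequence of convex sets in a complete inner product space, all meeting a fixed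
ball, admits a convergent selection. -/
theorem exists_tendsto_of_antitone_convex {𝕜 H : Type*} [RCLike 𝕜] [NormedAddCommGroup H]
    [InnerProductSpace 𝕜 H] [NormedSpace ℝ H] [CompleteSpace H] {S : ℕ → Set H} (hS : Antitone S)
    (hconvex : ∀ n, Convex ℝ (S n)) {C : ℝ} (hC : ∀ n, ∃ z ∈ S n, ‖z‖ ≤ C) :
    ∃ (v : H) (z : ℕ → H), (∀ n, z n ∈ S n) ∧ Tendsto z atTop (𝓝 v) := by
  have hne : ∀ n, (S n).Nonempty := fun n => (hC n).imp fun _ h => h.1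
  set d : ℕ → ℝ := fun n => Metric.infDist 0 (S n)
  have hd_le : ∀ n, ∀ w ∈ S n, d n ≤ ‖w‖ := fun n w hw => by
    simpa using Metric.infDist_le_dist_of_mem (x := (0 : H)) hw
  have hmono : Monotone d := fun m n h => Metric.infDist_le_infDist_of_subset (hS h) (hne n)
  have hbdd : BddAbove (Set.range d) := by
    refine ⟨C, ?_⟩
    rintro _ ⟨n, rfl⟩
    obtain ⟨w, hw, hwC⟩ := hC n
    exact (hd_le n w hw).trans hwC
  set L : ℝ := ⨆ n, d n
  have hdL : Tendsto d atTop (𝓝 L) := tendsto_atTop_ciSup hmono hbdd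
  have hd_le_L : ∀ n, d n ≤ L := le_ciSup hbdd
  have hex : ∀ n : ℕ, ∃ w ∈ S n, ‖w‖ < d n + 1 / ((n : ℝ) + 1) := fun n => by
    simpa using (Metric.infDist_lt_iff (x := (0 : H)) (hne n)).1
      (lt_add_of_pos_right (d n) (Nat.one_div_pos_of_nat (α := ℝ) (n := n)))
  choose z hz hz_lt using hex
  set b : ℕ → ℝ := fun N => √(4 * ((L + 1 / ((N : ℝ) + 1)) ^ 2 - d N ^ 2))
  have hb_lim : Tendsto b atTop (𝓝 0) := by
    have := (((((tendsto_one_div_add_atTop_nhds_zero_nat (𝕜 := ℝ)).const_add L).pow 2).sub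
      (hdL.pow 2)).const_mul 4).sqrt
    simpa only [add_zero, sub_self, mul_zero, Real.sqrt_zero] using this
  have hcauchy : CauchySeq z := by
    refine cauchySeq_of_le_tendsto_0 b (fun n m N hn hm => ?_) hb_lim
    have hz_le : ∀ k, N ≤ k → ‖z k‖ ^ 2 ≤ (L + 1 / ((N : ℝ) + 1)) ^ 2 := fun k hk => by
      have h₁ : 1 / ((k : ℝ) + 1) ≤ 1 / ((N : ℝ) + 1) := Nat.one_div_le_one_div hk
      have h₂ : ‖z k‖ ≤ L + 1 / ((N : ℝ) + 1) := by linarith [hz_lt k, hd_le_L k]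
      gcongr
    have hmid : d N ≤ ‖z n + z m‖ / 2 := by
      have h := hd_le N _ ((hconvex N).midpoint_mem (hS hn (hz n)) (hS hm (hz m)))
      rw [midpoint_eq_smul_add, norm_smul] at h
      norm_num at h
      linarith
    have hmid_sq : d N ^ 2 ≤ (‖z n + z m‖ / 2) ^ 2 := by
      have : 0 ≤ d N := Metric.infDist_nonneg
      gcongr
    rw [dist_eq_norm]
    refine Real.le_sqrt_of_sq_le ?_
    nlinarith [parallelogram_law_with_norm 𝕜 (z n) (z m), hz_le n hn, hz_le m hm]
  obtain ⟨v, hv⟩ := cauchySeq_tendsto_of_complete hcauchy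
  exact ⟨v, z, hz, hv⟩

/-- Verding–Van Daele lemma: if a net `(x_i)` in the domain of a linear map `Λ` into a Hilbert
space converges in norm to `x` and `(Λ x_i)` is bounded, then some sequence of convex
combinations of the `x_i` converges in norm to `x` while its `Λ`-images converge in `H`. -/
theorem verding_van_daele_convex_combinations
    {E : Type*} [NormedAddCommGroup E] [NormedSpace ℂ E]
    {H : Type*} [NormedAddCommGroup H] [InnerProductSpace ℂ H] [CompleteSpace H]
    (D : Submodule ℂ E) (Λ : D →ₗ[ℂ] H)
    {ι : Type*} [Preorder ι] [IsDirected ι (· ≤ ·)] [Nonempty ι]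
    (x : ι → D) (x₀ : E)
    (hconv : Tendsto (fun i => (x i : E)) atTop (𝓝 x₀))
    (hbdd : ∃ C : ℝ, ∀ i, ‖Λ (x i)‖ ≤ C) :
    ∃ (v : H) (y : ℕ → D),
      (∀ n, (y n : E) ∈ convexHull ℝ (Set.range fun i => (x i : E))) ∧
      Tendsto (fun n => (y n : E)) atTop (𝓝 x₀) ∧
      Tendsto (fun n => Λ (y n)) atTop (𝓝 v) := by
  obtain ⟨C, hC⟩ := hbdd
  set K : Set E := convexHull ℝ (Set.range fun i => (x i : E))
  set A : ℕ → Set D := fun n =>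
    {y | (y : E) ∈ K ∩ Metric.ball x₀ (1 / ((n : ℝ) + 1))}
  have hA : Antitone A := fun m n h y hy =>
    ⟨hy.1, Metric.ball_subset_ball (Nat.one_div_le_one_div h) hy.2⟩
  have hA_convex : ∀ n, Convex ℝ (A n) := fun n =>
    ((convex_convexHull ℝ _).inter (convex_ball _ _)).linear_preimage
      (D.subtype.restrictScalars ℝ)
  obtain ⟨v, z, hz, hv⟩ := exists_tendsto_of_antitone_convex (𝕜 := ℂ)
    (S := fun n => Λ '' A n) (fun m n h => Set.image_mono (hA h))
    (fun n => (hA_convex n).linear_image (Λ.restrictScalars ℝ)) (C := C) (fun n => by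
      obtain ⟨i, hi⟩ := (hconv.eventually
        (Metric.ball_mem_nhds x₀ (Nat.one_div_pos_of_nat (n := n)))).exists
      exact ⟨_, ⟨x i, ⟨subset_convexHull ℝ _ ⟨i, rfl⟩, hi⟩, rfl⟩, hC i⟩)
  choose y hy hyz using hz
  refine ⟨v, y, fun n => (hy n).1, ?_, by simpa only [hyz] using hv⟩
  exact tendsto_iff_dist_tendsto_zero.2 <| squeeze_zero (fun _ => dist_nonneg)
    (fun n => (Metric.mem_ball.1 (hy n).2).le) tendsto_one_div_add_atTop_nhds_zero_nat
end

section
/- Let M be a von Neumann algebra acting on a Hilbert space K, let H be a Hilbert space, and let Λ be a linear map from a linear subspace D(Λ) ⊆ M into H. Let (x_i)_{i∈I} be a net in D(Λ) (I a nonempty directed set) and x ∈ M such that (x_i) converges to x in the strong* sense, i.e., for every w ∈ K one has ‖x_i w − x w‖ → 0 and ‖x_i* w − x* w‖ → 0, and such that the family (Λ(x_i))_{i∈I} is bounded in H. Then there exists v ∈ H with the following property: for every ε > 0 and every finite subset F ⊆ K there exists y in the convex hull of {x_i : i ∈ I} (so y ∈ D(Λ)) with ‖Λ(y) − v‖ ≤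 ε and, for every w ∈ F, ‖(x − y) w‖ ≤ ε and ‖(x* − y*) w‖ ≤ ε. (In other words, there is a net in the convex hull of {x_i} converging strongly* to x whose Λ-images converge to v.) -/
open Filter Topology

/-- A decreasing net of nonempty closed convex subsets of a real Hilbert space, all of which meet
a fixed ball, has nonempty intersection. -/
theorem exists_mem_forall_of_antitone_convex {E : Type*} [NormedAddCommGroup E]
    [InnerProductSpace ℝ E] [CompleteSpace E] {ι : Type*} [Preorder ι] [IsDirected ι (· ≤ ·)]
    [Nonempty ι] (S : ι → Set E) (hanti : Antitone S) (hclosed : ∀ i, IsClosed (S i))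
    (hconvex : ∀ i, Convex ℝ (S i)) (C : ℝ) (hC : ∀ i, ∃ z ∈ S i, ‖z‖ ≤ C) :
    ∃ v, ∀ i, v ∈ S i := by
  have hmin : ∀ i, ∃ p ∈ S i, ∀ z ∈ S i, ‖p‖ ≤ ‖z‖ := by
    intro i
    obtain ⟨p, hp, hpmin⟩ := exists_norm_eq_iInf_of_complete_convex
      ((hC i).imp fun _ h => h.1) (hclosed i).isComplete (hconvex i) 0
    refine ⟨p, hp, fun z hz => ?_⟩
    have hle : (⨅ w : S i, ‖(0 : E) - w‖) ≤ ‖(0 : E) - z‖ :=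
      ciInf_le ⟨0, by rintro _ ⟨w, rfl⟩; exact norm_nonneg _⟩ (⟨z, hz⟩ : S i)
    rw [← hpmin] at hle
    simpa using hle
  choose p hp hpmin using hmin
  have hbound : ∀ i, ‖p i‖ ^ 2 ≤ C ^ 2 := by
    intro i
    obtain ⟨z, hz, hzC⟩ := hC i
    exact pow_le_pow_left₀ (norm_nonneg _) ((hpmin i z hz).trans hzC) 2
  have hdist : ∀ i j, i ≤ j → ‖p i - p j‖ ^ 2 ≤ 2 * (‖p j‖ ^ 2 - ‖p i‖ ^ 2) := by
    intro i j hij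
    have hmid := hpmin i _ (hconvex i (hp i) (hanti hij (hp j))
      (by norm_num : (0 : ℝ) ≤ 1 / 2) (by norm_num : (0 : ℝ) ≤ 1 / 2) (by norm_num))
    rw [← smul_add, norm_smul, Real.norm_of_nonneg (by norm_num)] at hmid
    have hpar := parallelogram_law_with_norm ℝ (p i) (p j)
    nlinarith [norm_nonneg (p i)]
  have hbdd : BddAbove (Set.range fun i => ‖p i‖ ^ 2) :=
    ⟨C ^ 2, by rintro _ ⟨i, rfl⟩; exact hbound i⟩
  have hcauchy : Cauchy (map p atTop) := by
    refine Metric.cauchy_iff.2 ⟨inferInstance, fun ε hε => ?_⟩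
    obtain ⟨i, hi⟩ := exists_lt_of_lt_ciSup
      (show (⨆ i, ‖p i‖ ^ 2) - ε ^ 2 / 8 < ⨆ i, ‖p i‖ ^ 2 by linarith [pow_pos hε 2])
    have hnear : ∀ j, i ≤ j → ‖p i - p j‖ < ε / 2 := by
      intro j hij
      have := hdist i j hij
      have := le_ciSup hbdd j
      exact lt_of_pow_lt_pow_left₀ 2 (by positivity) (by linarith)
    refine ⟨p '' Set.Ici i, image_mem_map (Ici_mem_atTop i), ?_⟩
    rintro _ ⟨j, hj, rfl⟩ _ ⟨k, hk, rfl⟩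
    calc dist (p j) (p k) ≤ dist (p i) (p j) + dist (p i) (p k) := dist_triangle_left _ _ _
      _ < ε := by
        rw [dist_eq_norm, dist_eq_norm]
        linarith [hnear j hj, hnear k hk]
  obtain ⟨v, hv⟩ := CompleteSpace.complete hcauchy
  refine ⟨v, fun i => (hclosed i).mem_of_tendsto (f := p) (b := atTop) hv ?_⟩
  filter_upwards [Ici_mem_atTop i] with j hj using hanti hj (hp j)

/-- Strong* version of the Verding–Van Daele lemma: if a net `(x_i)` in the domain of a linear
map `Λ` on a von Neumann algebra `M ⊆ B(K)` converges strongly* to `x ∈ M` and `(Λ x_i)` is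
bounded, then there is a vector `v ∈ H` such that elements of the convex hull of `{x_i}`
approximate `x` strongly* while their `Λ`-images approximate `v`. -/
theorem verding_van_daele_strong_star
    {K : Type*} [NormedAddCommGroup K] [InnerProductSpace ℂ K] [CompleteSpace K]
    (M : VonNeumannAlgebra K)
    {H : Type*} [NormedAddCommGroup H] [InnerProductSpace ℂ H] [CompleteSpace H]
    (D : Submodule ℂ (K →L[ℂ] K)) (hD : (D : Set (K →L[ℂ] K)) ⊆ M)
    (Λ : D →ₗ[ℂ] H)
    {ι : Type*} [Preorder ι] [IsDirected ι (· ≤ ·)] [Nonempty ι]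
    (x : ι → D) (x₀ : K →L[ℂ] K) (hx₀ : x₀ ∈ M)
    (hconv : ∀ w : K,
      Tendsto (fun i => ‖(x i : K →L[ℂ] K) w - x₀ w‖) atTop (𝓝 0) ∧
      Tendsto (fun i => ‖(star (x i : K →L[ℂ] K)) w - (star x₀) w‖) atTop (𝓝 0))
    (hbdd : ∃ C : ℝ, ∀ i, ‖Λ (x i)‖ ≤ C) :
    ∃ v : H, ∀ ε > (0 : ℝ), ∀ F : Finset K, ∃ y : D,
      ((y : K →L[ℂ] K) ∈ convexHull ℝ (Set.range fun i => (x i : K →L[ℂ] K))) ∧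
      ‖Λ y - v‖ ≤ ε ∧
      ∀ w ∈ F, ‖(x₀ - (y : K →L[ℂ] K)) w‖ ≤ ε ∧
        ‖(star x₀ - star (y : K →L[ℂ] K)) w‖ ≤ ε := by
  obtain ⟨C, hC⟩ := hbdd
  let _ : InnerProductSpace ℝ H := InnerProductSpace.complexToReal
  let L : D →ₗ[ℝ] H := Λ.restrictScalars ℝ
  let T : ι → Set D := fun i => convexHull ℝ (x '' Set.Ici i)
  obtain ⟨v, hv⟩ := exists_mem_forall_of_antitone_convex (fun i => closure (L '' T i))
    (fun i j hij => closure_mono (Set.image_mono (convexHull_mono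
      (Set.image_mono (Set.Ici_subset_Ici.2 hij)))))
    (fun _ => isClosed_closure)
    (fun i => ((convex_convexHull ℝ _).linear_image L).closure) C
    (fun i => ⟨L (x i), subset_closure (Set.mem_image_of_mem _
      (subset_convexHull ℝ _ (Set.mem_image_of_mem _ Set.self_mem_Ici))), hC i⟩)
  refine ⟨v, fun ε hε F => ?_⟩
  have htail : ∀ᶠ i in atTop, ∀ w ∈ F, ‖(x i : K →L[ℂ] K) w - x₀ w‖ < ε ∧
      ‖(star (x i : K →L[ℂ] K)) w - (star x₀) w‖ < ε :=
    (Filter.eventually_all_finset F).2 fun w _ =>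
      ((hconv w).1.eventually_lt_const hε).and ((hconv w).2.eventually_lt_const hε)
  obtain ⟨i, hi⟩ := eventually_atTop.1 htail
  obtain ⟨_, ⟨y, hy, rfl⟩, hyv⟩ := Metric.mem_closure_iff.1 (hv i) ε hε
  refine ⟨y, ?_, ?_, fun w hw => ⟨?_, ?_⟩⟩
  · have hmem := Set.mem_image_of_mem (D.subtype.restrictScalars ℝ) hy
    rw [LinearMap.image_convexHull] at hmem
    refine convexHull_mono ?_ hmem
    rintro _ ⟨_, ⟨j, _, rfl⟩, rfl⟩
    exact ⟨j, rfl⟩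
  · rw [← dist_eq_norm, dist_comm]
    exact hyv.le
  · let f : D →ₗ[ℝ] K :=
      { toFun := fun z => (z : K →L[ℂ] K) w
        map_add' := fun a b => by simp
        map_smul' := fun r a => by simp }
    have hsub : T i ⊆ f ⁻¹' Metric.closedBall (x₀ w) ε := by
      refine convexHull_min ?_ ((convex_closedBall _ _).linear_preimage f)
      rintro _ ⟨j, hj, rfl⟩
      exact mem_closedBall_iff_norm.2 (hi j hj w hw).1.le
    exact mem_closedBall_iff_norm'.1 (hsub hy)
  · let f : D →ₗ[ℝ] K :=
      { toFun := fun z => (star (z : K →L[ℂ] K)) w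
        map_add' := fun a b => by simp
        map_smul' := fun r a => by simp [star_smul] }
    have hsub : T i ⊆ f ⁻¹' Metric.closedBall (star x₀ w) ε := by
      refine convexHull_min ?_ ((convex_closedBall _ _).linear_preimage f)
      rintro _ ⟨j, hj, rfl⟩
      exact mem_closedBall_iff_norm.2 (hi j hj w hw).2.le
    exact mem_closedBall_iff_norm'.1 (hsub hy)
end

section
/- Let M be a von Neumann algebra acting on a Hilbert space K, let H be a Hilbert space, and let Λ be a linear map from a linear subspace D(Λ) ⊆ M into H. Let (x_i)_{i∈I} be a net in D(Λ) (I a nonempty directed set) and x ∈ M such that (x_i) converges to x σ-strongly*, i.e., for every sequence (w_n)_{n≥1} in K with ∑_n ‖w_n‖² < ∞ one has ∑_n ‖(x_i − x) w_n‖² → 0 and ∑_n ‖(x_i* − x*) w_n‖² → 0, and such that the family (Λ(x_i))_{i∈I} is bounded in H. Then there exists v ∈ H with the following property: for every ε > 0 and every finite collection S of sequences (w_n)_{n≥1} in K with ∑_n ‖w_n‖² < ∞, there exists y in the convex hull of {x_i : i ∈ I} (so y ∈ D(Λ)) with ‖Λ(y) − v‖ ≤ ε and, for every (w_n) ∈ S,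 ∑_n ‖(x − y) w_n‖² ≤ ε² and ∑_n ‖(x* − y*) w_n‖² ≤ ε². (In other words, there is a net in the convex hull of {x_i} converging σ-strongly* to x whose Λ-images converge to v.) -/
open Filter Topology

/-- In a Hilbert space, a decreasing net of nonempty closed convex sets that is uniformly bounded
has nonempty intersection. -/
theorem nonempty_iInter_of_antitone_convex_isClosed
    {E : Type*} [NormedAddCommGroup E] [InnerProductSpace ℝ E] [CompleteSpace E]
    {ι : Type*} [Preorder ι] [IsDirected ι (· ≤ ·)] [Nonempty ι]
    {C : ι → Set E} (hanti : Antitone C) (hne : ∀ i, (C i).Nonempty)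
    (hconv : ∀ i, Convex ℝ (C i)) (hclosed : ∀ i, IsClosed (C i))
    {R : ℝ} (hR : ∀ i, ∀ z ∈ C i, ‖z‖ ≤ R) : (⋂ i, C i).Nonempty := by
  have hmin : ∀ i, ∃ c ∈ C i, ∀ z ∈ C i, ‖z - c‖ ^ 2 ≤ ‖z‖ ^ 2 - ‖c‖ ^ 2 := by
    intro i
    obtain ⟨c, hc, hceq⟩ :=
      exists_norm_eq_iInf_of_complete_convex (hne i) (hclosed i).isComplete (hconv i) 0
    refine ⟨c, hc, fun z hz => ?_⟩
    have h := (norm_eq_iInf_iff_real_inner_le_zero (hconv i) hc).1 hceq z hz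
    rw [zero_sub, inner_neg_left, inner_sub_right, real_inner_self_eq_norm_sq,
      real_inner_comm] at h
    rw [norm_sub_sq_real]
    linarith
  choose c hc hcmin using hmin
  have hmono : Monotone fun i => ‖c i‖ ^ 2 := fun i j hij => by
    have := hcmin i (c j) (hanti hij (hc j))
    have := sq_nonneg ‖c j - c i‖
    dsimp only
    linarith
  have hbdd : BddAbove (Set.range fun i => ‖c i‖ ^ 2) := by
    refine ⟨R ^ 2, ?_⟩
    rintro _ ⟨i, rfl⟩
    exact pow_le_pow_left₀ (norm_nonneg _) (hR i _ (hc i)) 2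
  have hcauchy : Cauchy (map c atTop) := by
    refine Metric.cauchy_iff.2 ⟨inferInstance, fun ε hε => ?_⟩
    obtain ⟨i, hi⟩ := exists_lt_of_lt_ciSup
      (sub_lt_self (⨆ i, ‖c i‖ ^ 2) (by positivity : (0 : ℝ) < (ε / 2) ^ 2))
    have hclose : ∀ j, i ≤ j → dist (c j) (c i) < ε / 2 := by
      intro j hij
      rw [dist_eq_norm]
      refine lt_of_pow_lt_pow_left₀ 2 (by positivity) ?_
      have := hcmin i (c j) (hanti hij (hc j))
      have := le_ciSup hbdd j
      linarith
    refine ⟨c '' Set.Ici i, image_mem_map (Ici_mem_atTop i), ?_⟩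
    rintro _ ⟨j, hj, rfl⟩ _ ⟨k, hk, rfl⟩
    have := dist_triangle_right (c j) (c k) (c i)
    linarith [hclose j hj, hclose k hk]
  obtain ⟨v, hv⟩ := CompleteSpace.complete hcauchy
  refine ⟨v, Set.mem_iInter.2 fun i => ?_⟩
  refine (hclosed i).mem_of_tendsto (f := c) (b := atTop) hv ?_
  filter_upwards [Ici_mem_atTop i] with j hj using hanti hj (hc j)

/-- A bounded operator maps square-summable sequences to square-summable sequences. -/
theorem ContinuousLinearMap.summable_norm_sq_apply
    {K : Type*} [NormedAddCommGroup K] [NormedSpace ℂ K] (T : K →L[ℂ] K) {w : ℕ → K}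
    (hw : Summable fun n => ‖w n‖ ^ 2) : Summable fun n => ‖T (w n)‖ ^ 2 := by
  refine (hw.mul_left (‖T‖ ^ 2)).of_nonneg_of_le (fun n => sq_nonneg _) fun n => ?_
  rw [← mul_pow]
  exact pow_le_pow_left₀ (norm_nonneg _) (T.le_opNorm _) 2

/-- The squared σ-strong seminorm attached to a square-summable sequence is convex. -/
theorem convexOn_tsum_norm_sq_apply
    {K : Type*} [NormedAddCommGroup K] [NormedSpace ℂ K] {w : ℕ → K}
    (hw : Summable fun n => ‖w n‖ ^ 2) :
    ConvexOn ℝ Set.univ fun T : K →L[ℂ] K => ∑' n, ‖T (w n)‖ ^ 2 := by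
  refine ⟨convex_univ, fun S _ T _ a b ha hb hab => ?_⟩
  have hS := (S.summable_norm_sq_apply hw).mul_left a
  have hT := (T.summable_norm_sq_apply hw).mul_left b
  simp only [smul_eq_mul]
  rw [← tsum_mul_left, ← tsum_mul_left, ← hS.tsum_add hT]
  refine ((a • S + b • T).summable_norm_sq_apply hw).tsum_le_tsum (fun n => ?_) (hS.add hT)
  have hsq : ConvexOn ℝ Set.univ fun z : K => ‖z‖ ^ 2 :=
    (convexOn_norm convex_univ).pow (fun _ _ => norm_nonneg _) 2
  exact hsq.2 (Set.mem_univ (S (w n))) (Set.mem_univ (T (w n))) ha hb hab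

/-- σ-strong* version of the Verding–Van Daele lemma: if a net `(x_i)` in the domain of a
linear map `Λ` on a von Neumann algebra `M ⊆ B(K)` converges σ-strongly* to `x ∈ M` and
`(Λ x_i)` is bounded, then there is a vector `v ∈ H` such that elements of the convex hull of
`{x_i}` approximate `x` σ-strongly* while their `Λ`-images approximate `v`. -/
theorem verding_van_daele_sigma_strong_star
    {K : Type*} [NormedAddCommGroup K] [InnerProductSpace ℂ K] [CompleteSpace K]
    (M : VonNeumannAlgebra K)
    {H : Type*} [NormedAddCommGroup H] [InnerProductSpace ℂ H] [CompleteSpace H]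
    (D : Submodule ℂ (K →L[ℂ] K)) (hD : (D : Set (K →L[ℂ] K)) ⊆ M)
    (Λ : D →ₗ[ℂ] H)
    {ι : Type*} [Preorder ι] [IsDirected ι (· ≤ ·)] [Nonempty ι]
    (x : ι → D) (x₀ : K →L[ℂ] K) (hx₀ : x₀ ∈ M)
    (hconv : ∀ w : ℕ → K, Summable (fun n => ‖w n‖ ^ 2) →
      Tendsto (fun i => ∑' n, ‖((x i : K →L[ℂ] K) - x₀) (w n)‖ ^ 2) atTop (𝓝 0) ∧
      Tendsto (fun i => ∑' n, ‖(star (x i : K →L[ℂ] K) - star x₀) (w n)‖ ^ 2) atTop (𝓝 0))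
    (hbdd : ∃ C : ℝ, ∀ i, ‖Λ (x i)‖ ≤ C) :
    ∃ v : H, ∀ ε > (0 : ℝ), ∀ S : Finset (ℕ → K),
      (∀ w ∈ S, Summable fun n => ‖w n‖ ^ 2) → ∃ y : D,
      ((y : K →L[ℂ] K) ∈ convexHull ℝ (Set.range fun i => (x i : K →L[ℂ] K))) ∧
      ‖Λ y - v‖ ≤ ε ∧
      ∀ w ∈ S, (∑' n, ‖(x₀ - (y : K →L[ℂ] K)) (w n)‖ ^ 2) ≤ ε ^ 2 ∧
        (∑' n, ‖(star x₀ - star (y : K →L[ℂ] K)) (w n)‖ ^ 2) ≤ ε ^ 2 := by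
  obtain ⟨C, hC⟩ := hbdd
  let : InnerProductSpace ℝ H := InnerProductSpace.rclikeToReal ℂ H
  let L : D →ₗ[ℝ] H := Λ.restrictScalars ℝ
  let tail : ι → Set D := fun i => convexHull ℝ (x '' Set.Ici i)
  have hbound : ∀ i, closure (L '' tail i) ⊆ Metric.closedBall 0 C := by
    intro i
    refine closure_minimal ?_ Metric.isClosed_closedBall
    rw [L.image_convexHull]
    refine convexHull_min ?_ (convex_closedBall 0 C)
    rintro _ ⟨_, ⟨j, -, rfl⟩, rfl⟩
    exact mem_closedBall_zero_iff.2 (hC j)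
  obtain ⟨v, hv⟩ := nonempty_iInter_of_antitone_convex_isClosed
    (C := fun i => closure (L '' tail i))
    (fun i j hij => closure_mono (Set.image_mono (convexHull_mono
      (Set.image_mono (Set.Ici_subset_Ici.2 hij)))))
    (fun i => ⟨L (x i), subset_closure (Set.mem_image_of_mem _
      (subset_convexHull ℝ _ (Set.mem_image_of_mem _ Set.self_mem_Ici)))⟩)
    (fun i => ((convex_convexHull ℝ _).linear_image L).closure)
    (fun i => isClosed_closure)
    (fun i z hz => mem_closedBall_zero_iff.1 (hbound i hz))
  refine ⟨v, fun ε hε S hS => ?_⟩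
  let good : Set (K →L[ℂ] K) := {y | ∀ w ∈ S, (∑' n, ‖(x₀ - y) (w n)‖ ^ 2) ≤ ε ^ 2 ∧
    (∑' n, ‖(star x₀ - star y) (w n)‖ ^ 2) ≤ ε ^ 2}
  have hgood : Convex ℝ good := by
    intro y hy z hz a b ha hb hab w hw
    have hcomb : ∀ p q r : K →L[ℂ] K, p - (a • q + b • r) = a • (p - q) + b • (p - r) := by
      intro p q r
      rw [smul_sub, smul_sub, sub_add_sub_comm, ← add_smul, hab, one_smul]
    have hle := fun r : ℝ => (convexOn_tsum_norm_sq_apply (hS w hw)).convex_le r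
    constructor
    · rw [hcomb]
      exact (hle (ε ^ 2) ⟨Set.mem_univ _, (hy w hw).1⟩ ⟨Set.mem_univ _, (hz w hw).1⟩
        ha hb hab).2
    · rw [star_add, star_smul, star_smul, star_trivial a, star_trivial b, hcomb]
      exact (hle (ε ^ 2) ⟨Set.mem_univ _, (hy w hw).2⟩ ⟨Set.mem_univ _, (hz w hw).2⟩
        ha hb hab).2
  have hev : ∀ᶠ i in atTop, (x i : K →L[ℂ] K) ∈ good := by
    refine (eventually_all_finset S).2 fun w hw => ?_
    have hε2 : (0 : ℝ) < ε ^ 2 := by positivity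
    filter_upwards [(hconv w (hS w hw)).1.eventually_lt_const hε2,
      (hconv w (hS w hw)).2.eventually_lt_const hε2] with i h₁ h₂
    simp only [sub_apply] at h₁ h₂ ⊢
    simp only [norm_sub_rev (x₀ _), norm_sub_rev ((star x₀) _)]
    exact ⟨h₁.le, h₂.le⟩
  obtain ⟨i, hi⟩ := eventually_atTop.1 hev
  obtain ⟨_, ⟨y, hy, rfl⟩, hdist⟩ := Metric.mem_closure_iff.1 (Set.mem_iInter.1 hv i) ε hε
  have hyi : (y : K →L[ℂ] K) ∈
      convexHull ℝ ((fun j => (x j : K →L[ℂ] K)) '' Set.Ici i) := by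
    have := Set.mem_image_of_mem (D.subtype.restrictScalars ℝ) hy
    rwa [LinearMap.image_convexHull, Set.image_image] at this
  refine ⟨y, convexHull_mono (Set.image_subset_range _ _) hyi, ?_, ?_⟩
  · rw [dist_comm, dist_eq_norm] at hdist
    exact hdist.le
  · refine convexHull_min ?_ hgood hyi
    rintro _ ⟨j, hj, rfl⟩
    exact hi j hj
end
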